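/- Let (R, m) be a complete Gorenstein local ring, I ⊂ R an ideal, A = R/I, and K(A) = Ext_R^c(A, R) with c = dim R − dim A the canonical module of A. Then the following are equivalent: (i) K(A) is indecomposable as an R-module; (ii) V(0_d) ⊂ Spec A is connected in codimension one (equivalently, the graph G_A is connected); (iii) K(K(A)) ≅ Hom_R(K(A), K(A)) is a local ring. -/

import Mathlib

open CategoryTheory CategoryTheory.Limits Opposite IsLocalRing

noncomputable section

universe u

/-- `Ext^i_R(M, N)` as an `R`-module. -/
abbrev ExtM (R : Type u) [CommRing R] (i : ℕ) (M N : ModuleCat.{u} R) : ModuleCat.{u} R :=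
  ((Ext R (ModuleCat.{u} R) i).obj (op M)).obj N

/-- The height of an ideal: the infimum of the heights of the primes containing it. -/
def idealHeight (R : Type u) [CommRing R] (I : Ideal R) : ℕ∞ :=
  ⨅ p : {p : PrimeSpectrum R // I ≤ p.asIdeal}, Order.height (p : PrimeSpectrum R)

/-- A Noetherian local ring `(R, 𝔪, k)` is Gorenstein if `Ext^i_R(k, R)` vanishes for
`i ≠ dim R` and is isomorphic to `k` in degree `dim R`. -/
def IsGorensteinLocalRing (R : Type u) [CommRing R] [IsLocalRing R] : Prop :=
  IsNoetherianRing R ∧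
    ∃ n : ℕ, ringKrullDim R = n ∧
      (∀ i : ℕ, i ≠ n →
        Subsingleton (ExtM R i (ModuleCat.of R (R ⧸ maximalIdeal R)) (ModuleCat.of R R))) ∧
      Nonempty ((ExtM R n (ModuleCat.of R (R ⧸ maximalIdeal R)) (ModuleCat.of R R)) ≃ₗ[R]
        (R ⧸ maximalIdeal R))

/-- The graph `𝔾_A` of a commutative ring `A`: vertices are the primes `p` with
`dim A/p = dim A`, two distinct vertices being joined by an edge iff the ideal
`p + q` has height one. -/
def ringGraph (A : Type u) [CommRing A] :
    SimpleGraph {p : Ideal A // p.IsPrime ∧ ringKrullDim (A ⧸ p) = ringKrullDim A} :=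
  SimpleGraph.fromRel (fun p q => idealHeight A (p.1 ⊔ q.1) = 1)

section Ext

variable {R : Type u} [CommRing R]

/-- Postcomposition with `f` as a map of the complexes `Hom(P, Y) ⟶ Hom(P, Z)`. -/
def homComplexMap {N : ModuleCat.{u} R} (P : ProjectiveResolution N)
    {Y Z : ModuleCat.{u} R} (f : Y ⟶ Z) :
    P.complex.linearYonedaObj R Y ⟶ P.complex.linearYonedaObj R Z where
  f i := ModuleCat.ofHom (Linear.rightComp R _ f)
  comm' i j h := by
    ext φ
    exact (Category.assoc (P.complex.d j i) φ f).symm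

/-- The short complex of complexes obtained by applying `Hom(P, -)` to a short complex. -/
def homShortComplex {N : ModuleCat.{u} R} (P : ProjectiveResolution N)
    (S : ShortComplex (ModuleCat.{u} R)) : ShortComplex (CochainComplex (ModuleCat.{u} R) ℕ) where
  f := homComplexMap P S.f
  g := homComplexMap P S.g
  zero := by
    ext i φ : 4
    have (ψ : P.complex.X i ⟶ S.X₁) : (ψ ≫ S.f) ≫ S.g = 0 := by
      rw [Category.assoc, S.zero, comp_zero]
    exact this φ

theorem homShortComplex_shortExact {N : ModuleCat.{u} R} (P : ProjectiveResolution N)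
    {S : ShortComplex (ModuleCat.{u} R)} (hS : S.ShortExact) :
    (homShortComplex P S).ShortExact := by
  apply HomologicalComplex.shortExact_of_degreewise_shortExact
  intro i
  have := hS.mono_f
  have := hS.epi_g
  refine ShortComplex.ShortExact.mk' ?_ ?_ ?_
  · rw [ShortComplex.moduleCat_exact_iff]
    intro (φ : P.complex.X i ⟶ S.X₂) h
    have h' : φ ≫ S.g = 0 := h
    exact ⟨hS.exact.lift φ h', hS.exact.lift_f φ h'⟩
  · rw [ModuleCat.mono_iff_injective]
    intro (a : P.complex.X i ⟶ S.X₁) b h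
    have h' : a ≫ S.f = b ≫ S.f := h
    exact (cancel_mono _).1 h'
  · rw [ModuleCat.epi_iff_surjective]
    intro (a : P.complex.X i ⟶ S.X₃)
    exact ⟨Projective.factorThru a S.g, Projective.factorThru_comp a S.g⟩

theorem homComplexMap_smul_id {N : ModuleCat.{u} R} (P : ProjectiveResolution N)
    (Y : ModuleCat.{u} R) (x : R) :
    homComplexMap P (x • 𝟙 Y) = x • 𝟙 _ := by
  ext i φ : 4
  have (ψ : P.complex.X i ⟶ Y) : ψ ≫ (x • 𝟙 Y) = x • ψ := by simp
  exact this φ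

theorem homologyMap_smul_id (K : CochainComplex (ModuleCat.{u} R) ℕ) (x : R) (i : ℕ) :
    HomologicalComplex.homologyMap (x • 𝟙 K) i = x • 𝟙 _ := by
  have h : (HomologicalComplex.shortComplexFunctor _ _ i).map (x • 𝟙 K) = x • 𝟙 (K.sc i) := rfl
  rw [HomologicalComplex.homologyMap, h, ShortComplex.homologyMap_smul, ShortComplex.homologyMap_id]
  rfl

theorem smul_linearYonedaObj_homology_eq_zero {N : ModuleCat.{u} R} (P : ProjectiveResolution N)
    (Y : ModuleCat.{u} R) (x : R) (hx : ∀ a : N, x • a = 0) (i : ℕ)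
    (z : (P.complex.linearYonedaObj R Y).homology i) : x • z = 0 := by
  have h0 : (x • 𝟙 P.complex) ≫ P.π = 0 := by
    rw [Linear.smul_comp, Category.id_comp]
    have h1 : x • 𝟙 N = 0 := by
      ext a
      exact hx a
    have h2 : P.π ≫ (ChainComplex.single₀ (ModuleCat.{u} R)).map (x • 𝟙 N) = x • P.π := by
      ext
      have (ψ : P.complex.X 0 ⟶ N) : ψ ≫ (x • 𝟙 N) = x • ψ := by simp
      exact congr($(this (P.π.f 0)).hom _)
    rw [← h2, h1, Functor.map_zero, comp_zero]
  have ho := ProjectiveResolution.liftHomotopyZero _ h0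
  have ho' : Homotopy (x • 𝟙 (P.complex.linearYonedaObj R Y)) 0 :=
    { hom := fun j i => ModuleCat.ofHom (Linear.leftComp R Y (ho.hom i j))
      zero := by
        intro i j h
        have : ho.hom j i = 0 := ho.zero _ _ h
        rw [this]
        ext (φ : P.complex.X i ⟶ Y) : 2
        exact zero_comp (f := φ)
      comm := by
        intro i
        ext (φ : P.complex.X i ⟶ Y) : 2
        have h1 := congr($(ho.comm i) ≫ φ)
        simp only [Preadditive.add_comp, HomologicalComplex.zero_f, add_zero] at h1
        have h2 : (x • 𝟙 P.complex).f i ≫ φ = x • φ := by simp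
        rw [h2, add_comm] at h1
        rw [HomologicalComplex.zero_f, add_zero]
        exact h1 }
  have := ho'.homologyMap_eq i
  rw [HomologicalComplex.homologyMap_zero, homologyMap_smul_id] at this
  exact congr($(this).hom z)

/-- The connecting map of the long exact `Ext` sequence for multiplication by a regular element. -/
theorem exists_ext_delta (N M : ModuleCat.{u} R) (x : R) (hx : IsSMulRegular M x) (i : ℕ) :
    ∃ δ : ExtM R i N (ModuleCat.of R (QuotSMulTop x M)) →ₗ[R] ExtM R (i + 1) N M,
      (Subsingleton (ExtM R i N M) → Function.Injective δ) ∧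
        ((∀ a : N, x • a = 0) → Function.Surjective δ) := by
  let P := ProjectiveResolution.of N
  have hS := homShortComplex_shortExact P hx.smulShortComplex_shortExact
  let e₁ := (P.isoExt (R := R) i (ModuleCat.of R (QuotSMulTop x M))).toLinearEquiv
  let e₂ := (P.isoExt (R := R) (i + 1) M).toLinearEquiv
  let e₃ := (P.isoExt (R := R) i M).toLinearEquiv
  let δ : (P.complex.linearYonedaObj R (ModuleCat.of R (QuotSMulTop x M))).homology i →ₗ[R]
      (P.complex.linearYonedaObj R M).homology (i + 1) := (hS.δ i (i + 1) rfl).hom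
  have hinj (h : Subsingleton (ExtM R i N M)) :
      Function.Injective δ := by
    have : Subsingleton ((P.complex.linearYonedaObj R M).homology i) :=
      e₃.symm.injective.subsingleton
    have hex := hS.homology_exact₃ i (i + 1) rfl
    rw [ShortComplex.moduleCat_exact_iff] at hex
    rw [injective_iff_map_eq_zero]
    intro a ha
    obtain ⟨b, rfl⟩ := hex a ha
    have hb : b = 0 :=
      Subsingleton.elim (α := (P.complex.linearYonedaObj R M).homology i) _ _
    rw [hb]
    exact map_zero _
  have hsurj (h : ∀ a : N, x • a = 0) : Function.Surjective δ := by
    have hex := hS.homology_exact₁ i (i + 1) rfl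
    rw [ShortComplex.moduleCat_exact_iff] at hex
    intro a
    refine hex a ?_
    have h2 : HomologicalComplex.homologyMap
        (homShortComplex P (ModuleCat.smulShortComplex M x)).f (i + 1) = x • 𝟙 _ :=
      (congrArg (HomologicalComplex.homologyMap · (i + 1)) (homComplexMap_smul_id P M x)).trans
        (homologyMap_smul_id (P.complex.linearYonedaObj R M) x (i + 1))
    refine congr($(h2).hom a).trans ?_
    exact smul_linearYonedaObj_homology_eq_zero P M x h (i + 1) a
  exact ⟨e₂.symm.toLinearMap ∘ₗ δ ∘ₗ e₁.toLinearMap,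
    fun h => e₂.symm.injective.comp ((hinj h).comp e₁.injective),
    fun h => e₂.symm.surjective.comp ((hsurj h).comp e₁.surjective)⟩

theorem nonempty_ext_zero (N M : ModuleCat.{u} R) :
    Nonempty (ExtM R 0 N M ≃ₗ[R] (N →ₗ[R] M)) := by
  have : PreservesLimits ((linearYoneda R (ModuleCat.{u} R)).obj M) := by
    have : PreservesLimits
        (((linearYoneda R (ModuleCat.{u} R)).obj M) ⋙ forget (ModuleCat.{u} R)) :=
      inferInstanceAs (PreservesLimits (yoneda.obj M))
    exact preservesLimits_of_reflects_of_preserves _ (forget _)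
  have : PreservesFiniteLimits ((linearYoneda R (ModuleCat.{u} R)).obj M) := inferInstance
  have : PreservesFiniteColimits ((linearYoneda R (ModuleCat.{u} R)).obj M).rightOp :=
    preservesFiniteColimits_rightOp _
  have e := (((linearYoneda R (ModuleCat.{u} R)).obj M).rightOp.leftDerivedZeroIsoSelf.app N).unop
  exact ⟨e.symm.toLinearEquiv.trans (ModuleCat.homLinearEquiv (S := R))⟩

end Ext

section AssociatedElements

variable {R : Type*} [CommRing R] {M : Type*} [AddCommGroup M] [Module R M]

/-- The annihilator of `x` is exactly the ideal `P`. -/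
def AssElt (P : Ideal R) (x : M) : Prop := ∀ r : R, r • x = 0 ↔ r ∈ P

/-- Any two elements with annihilator `P` have a common nonzero multiple. -/
def Unif (M : Type*) [AddCommGroup M] [Module R M] (P : Ideal R) : Prop :=
  ∀ a b : M, AssElt P a → AssElt P b → ∃ r s : R, r • a = s • b ∧ r • a ≠ 0

theorem AssElt.smul {P : Ideal R} [hP : P.IsPrime] {x : M} (h : AssElt P x) {r : R}
    (hr : r ∉ P) : AssElt P (r • x) := fun s => by
  rw [smul_smul, h]
  exact ⟨fun hs => (hP.mem_or_mem hs).resolve_right hr, fun hs => P.mul_mem_right _ hs⟩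

theorem AssElt.ne_zero {P : Ideal R} [hP : P.IsPrime] {x : M} (h : AssElt P x) : x ≠ 0 :=
  fun h0 => hP.ne_top ((Ideal.eq_top_iff_one _).2 ((h 1).1 (by simp [h0])))

theorem assElt_coe_iff {P : Ideal R} {N : Submodule R M} {x : N} :
    AssElt P (x : M) ↔ AssElt P x := by
  refine forall_congr' fun r => ?_
  rw [← N.coe_smul, ZeroMemClass.coe_eq_zero]

/-- Below any prime containing the annihilator of `x` there is the annihilator of a
multiple of `x`. -/
theorem exists_assElt_smul [IsNoetherianRing R] (x : M) (Q : PrimeSpectrum R)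
    (hQ : ∀ r : R, r • x = 0 → r ∈ Q.asIdeal) :
    ∃ P : PrimeSpectrum R, P ≤ Q ∧ ∃ s : R, AssElt P.asIdeal (s • x) := by
  let N := Submodule.span R {x}
  have h1 : Module.annihilator R N ≤ Q.asIdeal := by
    intro r hr
    rw [← Submodule.annihilator] at hr
    exact hQ r (by simpa [N, Submodule.mem_annihilator_span_singleton] using hr)
  obtain ⟨P, hP, hPQ⟩ := Ideal.exists_minimalPrimes_le h1
  have h2 := Module.associatedPrimes.minimalPrimes_annihilator_subset_associatedPrimes R N hP
  obtain ⟨hPp, ⟨y, hy⟩, h3⟩ := isAssociatedPrime_iff.1 h2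
  obtain ⟨s, rfl⟩ := Submodule.mem_span_singleton.1 hy
  refine ⟨⟨P, hPp⟩, hPQ, s, fun r => ?_⟩
  simp only [h3, Submodule.mem_colon_singleton, Submodule.mem_bot]
  rw [← (Submodule.coe_eq_zero (p := N))]
  simp

theorem AssElt.mem_associatedPrimes [IsNoetherianRing R] {P : Ideal R} [hP : P.IsPrime] {x : M}
    (h : AssElt P x) : P ∈ associatedPrimes R M :=
  isAssociatedPrime_iff.2 ⟨hP, x, by ext r; simp [Submodule.mem_colon_singleton, h r]⟩

theorem exists_assElt_of_mem_associatedPrimes [IsNoetherianRing R] {P : Ideal R}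
    (h : P ∈ associatedPrimes R M) : ∃ x : M, AssElt P x := by
  obtain ⟨hPp, y, h3⟩ := isAssociatedPrime_iff.1 h
  exact ⟨y, fun r => by simp [h3, Submodule.mem_colon_singleton]⟩

theorem exists_assElt [IsNoetherianRing R] {x : M} (hx : x ≠ 0) :
    ∃ P : PrimeSpectrum R, ∃ s : R, AssElt P.asIdeal (s • x) := by
  have : Module.annihilator R (Submodule.span R {x}) ≠ ⊤ := fun h => hx <| by
    have h1 := (Ideal.eq_top_iff_one _).1 h
    rw [← Submodule.annihilator, Submodule.mem_annihilator_span_singleton] at h1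
    simpa using h1
  obtain ⟨Q, hQ, hle⟩ := Ideal.exists_le_maximal _ this
  obtain ⟨P, -, s, h⟩ := exists_assElt_smul x ⟨Q, hQ.isPrime⟩ fun r hr => hle <| by
    rwa [← Submodule.annihilator, Submodule.mem_annihilator_span_singleton]
  exact ⟨P, s, h⟩

/-- Prime avoidance: an ideal contained in no associated prime contains a regular element. -/
theorem exists_isSMulRegular_mem [IsNoetherianRing R] [Module.Finite R M] (J : Ideal R)
    (hJ : ∀ (P : PrimeSpectrum R) (y : M), AssElt P.asIdeal y → ¬ J ≤ P.asIdeal) :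
    ∃ x ∈ J, IsSMulRegular M x := by
  by_contra! hcon
  have hsub : (J : Set R) ⊆ ⋃ p ∈ associatedPrimes R M, (p : Set R) := by
    intro x hx
    have h := hcon x hx
    rw [isSMulRegular_iff_right_eq_zero_of_smul] at h
    push Not at h
    obtain ⟨y, hy, hy0⟩ := h
    obtain ⟨P, s, hs⟩ := exists_assElt (R := R) hy0
    have hP : P.asIdeal ∈ associatedPrimes R M := hs.mem_associatedPrimes
    refine Set.mem_biUnion hP ((hs x).1 ?_)
    rw [smul_comm, hy, smul_zero]
  obtain ⟨P, hP, hle⟩ := (Ideal.subset_union_prime_finite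
    (associatedPrimes.finite R M) (f := id) 0 0 (fun p hp _ _ => hp.1)).1 hsub
  obtain ⟨y, hy⟩ := exists_assElt_of_mem_associatedPrimes hP
  exact hJ ⟨P, hP.1⟩ y hy hle

theorem quotSMulTop_mk_eq_zero_iff {x : R} {y : M} :
    (Submodule.Quotient.mk y : QuotSMulTop x M) = 0 ↔ ∃ w : M, x • w = y := by
  rw [Submodule.Quotient.mk_eq_zero, Submodule.mem_smul_pointwise_iff_exists]
  simp

theorem assElt_quotSMulTop_mk_iff {x : R} {P : Ideal R} {y : M} :
    AssElt P (Submodule.Quotient.mk y : QuotSMulTop x M) ↔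
      ∀ r : R, (∃ w : M, x • w = r • y) ↔ r ∈ P := by
  refine forall_congr' fun r => ?_
  rw [← Submodule.Quotient.mk_smul, quotSMulTop_mk_eq_zero_iff]

/-- An associated prime of `M` propagates to one of `M / x M`. -/
theorem exists_assElt_quotSMulTop [IsNoetherianRing R] [Module.Finite R M] {x : R}
    (hx : IsSMulRegular M x) {P Q : PrimeSpectrum R} {m : M} (hm : AssElt P.asIdeal m)
    (hPQ : P ≤ Q) (hxQ : x ∈ Q.asIdeal) :
    ∃ q : PrimeSpectrum R, P ≤ q ∧ q ≤ Q ∧ x ∈ q.asIdeal ∧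
      ∃ y : M, AssElt q.asIdeal (Submodule.Quotient.mk y : QuotSMulTop x M) := by
  let N : Submodule R M :=
    { carrier := {w | ∀ r ∈ P.asIdeal, r • w = 0}
      add_mem' := fun ha hb r hr => by rw [smul_add, ha r hr, hb r hr, add_zero]
      zero_mem' := fun r _ => smul_zero r
      smul_mem' := fun c w hw r hr => by rw [smul_comm, hw r hr, smul_zero] }
  have hmN : m ∈ N := fun r hr => (hm r).2 hr
  have hann : Module.annihilator R N ≤ Q.asIdeal := fun r hr => by
    refine hPQ ((hm r).1 ?_)
    have := Module.mem_annihilator.1 hr ⟨m, hmN⟩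
    simpa using congrArg Subtype.val this
  have hQ : Q ∈ Module.support R (QuotSMulTop x N) := by
    rw [Module.support_quotSMulTop]
    exact ⟨Module.mem_support_iff_of_finite.2 hann, by simpa using hxQ⟩
  rw [Module.mem_support_iff_exists_annihilator] at hQ
  obtain ⟨n, hn⟩ := hQ
  obtain ⟨q, hqQ, s, hq⟩ := exists_assElt_smul n Q fun r hr => hn
    ((Submodule.mem_annihilator_span_singleton _ _).2 hr)
  obtain ⟨y, rfl⟩ := Submodule.Quotient.mk_surjective _ n
  rw [← Submodule.Quotient.mk_smul, assElt_quotSMulTop_mk_iff] at hq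
  have key (r : R) : (∃ w : M, x • w = r • (s • y : N)) ↔ ∃ w : N, x • w = r • (s • y : N) := by
    refine ⟨fun ⟨w, hw⟩ => ⟨⟨w, fun p hp => ?_⟩, Subtype.ext hw⟩, fun ⟨w, hw⟩ =>
      ⟨w, congrArg Subtype.val hw⟩⟩
    refine hx ?_
    have := (r • (s • y : N)).2 p hp
    simp only at this ⊢
    rw [smul_zero, smul_comm, hw]
    exact this
  refine ⟨q, fun r hr => (hq r).1 ⟨0, ?_⟩, hqQ, (hq x).1 ⟨_, rfl⟩, ((s • y : N) : M), ?_⟩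
  · rw [smul_zero]
    exact (Subtype.ext ((s • y : N).2 r hr)).symm
  · rw [assElt_quotSMulTop_mk_iff]
    exact fun r => (key r).trans (hq r)

end AssociatedElements

theorem AssElt.notMem_of_isSMulRegular {R : Type*} [CommRing R] {M : Type*} [AddCommGroup M]
    [Module R M] {P : Ideal R} [hP : P.IsPrime] {y : M} (h : AssElt P y) {x : R}
    (hx : IsSMulRegular M x) : x ∉ P := fun hxP =>
  h.ne_zero (hx (by simpa using (h x).2 hxP))

theorem exists_assElt_le_of_mem_support {R : Type*} [CommRing R] [IsNoetherianRing R]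
    {M : Type*} [AddCommGroup M] [Module R M] {P : PrimeSpectrum R}
    (hP : P ∈ Module.support R M) :
    ∃ q : PrimeSpectrum R, q ≤ P ∧ ∃ y : M, AssElt q.asIdeal y := by
  obtain ⟨n, hn⟩ := Module.mem_support_iff_exists_annihilator.1 hP
  obtain ⟨q, hqQ, s, hq⟩ := exists_assElt_smul n P fun r hr => hn
    ((Submodule.mem_annihilator_span_singleton _ _).2 hr)
  exact ⟨q, hqQ, _, hq⟩

theorem AssElt.mem_support {R : Type*} [CommRing R] {M : Type*} [AddCommGroup M] [Module R M]
    {P Q : PrimeSpectrum R} {y : M} (h : AssElt P.asIdeal y) (hPQ : P ≤ Q) :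
    Q ∈ Module.support R M :=
  Module.mem_support_iff_exists_annihilator.2 ⟨y, fun r hr =>
    hPQ ((h r).1 ((Submodule.mem_annihilator_span_singleton _ _).1 hr))⟩

theorem eq_zero_of_subsingleton_ext_zero {R : Type u} [CommRing R] {M : Type u} [AddCommGroup M]
    [Module R M] {I : Ideal R}
    (h : Subsingleton (ExtM R 0 (ModuleCat.of R (R ⧸ I)) (ModuleCat.of R M)))
    {y : M} (hy : ∀ r ∈ I, r • y = 0) : y = 0 := by
  obtain ⟨e⟩ := nonempty_ext_zero (ModuleCat.of R (R ⧸ I)) (ModuleCat.of R M)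
  have := e.symm.injective.subsingleton
  let f : (R ⧸ I) →ₗ[R] M := Submodule.liftQ I (LinearMap.toSpanSingleton R M y)
    (fun r hr => by simpa using hy r hr)
  have hf : f = 0 := Subsingleton.elim (α := (ModuleCat.of R (R ⧸ I) →ₗ[R] ModuleCat.of R M)) f 0
  have h1 : f (Submodule.Quotient.mk 1) = 0 := by
    rw [hf]
    rfl
  rwa [Submodule.liftQ_apply, LinearMap.toSpanSingleton_apply, one_smul] at h1

section Good

variable {R : Type u} [CommRing R] [IsLocalRing R]

/-- `M` behaves like a Cohen–Macaulay module of dimension `t` and type at most one. -/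
structure Good (t : ℕ) (M : Type u) [AddCommGroup M] [Module R M] : Prop where
  vanish : ∀ i < t, Subsingleton
    (ExtM R i (ModuleCat.of R (R ⧸ maximalIdeal R)) (ModuleCat.of R M))
  top : ∃ f : ExtM R t (ModuleCat.of R (R ⧸ maximalIdeal R)) (ModuleCat.of R M) →ₗ[R]
    (R ⧸ maximalIdeal R), Function.Injective f
  dim : ∀ P : PrimeSpectrum R, P ∈ Module.support R M → Order.coheight P ≤ t

variable {M : Type u} [AddCommGroup M] [Module R M]

theorem Good.quotSMulTop [IsNoetherianRing R] [Module.Finite R M] {t : ℕ}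
    (h : Good (R := R) (t + 1) M) {x : R} (hx : IsSMulRegular M x) :
    Good (R := R) t (QuotSMulTop x M) where
  vanish i hi := by
    obtain ⟨δ, hδ, -⟩ := exists_ext_delta (ModuleCat.of R (R ⧸ maximalIdeal R))
      (ModuleCat.of R M) x hx i
    have := h.vanish (i + 1) (by lia)
    exact (hδ (h.vanish i (by lia))).subsingleton
  top := by
    obtain ⟨δ, hδ, -⟩ := exists_ext_delta (ModuleCat.of R (R ⧸ maximalIdeal R))
      (ModuleCat.of R M) x hx t
    obtain ⟨f, hf⟩ := h.top
    exact ⟨f ∘ₗ δ, hf.comp (hδ (h.vanish t (by lia)))⟩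
  dim P hP := by
    rw [Module.support_quotSMulTop] at hP
    obtain ⟨q, hqP, y, hy⟩ := exists_assElt_le_of_mem_support hP.1
    have hlt : q < P := lt_of_le_of_ne hqP fun h =>
      hy.notMem_of_isSMulRegular hx (h ▸ by simpa using hP.2)
    have h1 := h.dim q (hy.mem_support le_rfl)
    have h2 := (Order.coheight_add_one_le hlt).trans h1
    push_cast at h2
    exact (ENat.add_le_add_iff_right (by simp)).1 h2

theorem Good.le_coheight [IsNoetherianRing R] {t : ℕ} :
    ∀ {M : Type u} [AddCommGroup M] [Module R M] [Module.Finite R M] (_ : Good (R := R) t M)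
      {P : PrimeSpectrum R} {m : M} (_ : AssElt P.asIdeal m), (t : ℕ∞) ≤ Order.coheight P := by
  induction t with
  | zero => intros; simp
  | succ t ih =>
    intro M _ _ _ h P m hm
    obtain ⟨x, hxm, hx⟩ := exists_isSMulRegular_mem (M := M) (maximalIdeal R) fun Q y hy hle =>
      hy.ne_zero (eq_zero_of_subsingleton_ext_zero (h.vanish 0 (by lia))
        fun r hr => (hy r).2 (hle hr))
    obtain ⟨q, hPq, -, hxq, y, hy⟩ := exists_assElt_quotSMulTop hx hm
      (Q := closedPoint R) (le_maximalIdeal P.2.ne_top) hxm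
    have hlt : P < q := lt_of_le_of_ne hPq fun h =>
      hm.notMem_of_isSMulRegular hx (h ▸ hxq)
    refine le_trans ?_ (Order.coheight_add_one_le hlt)
    push_cast
    gcongr
    exact ih (h.quotSMulTop hx) hy

theorem Good.coheight_eq [IsNoetherianRing R] {t : ℕ} [Module.Finite R M]
    (h : Good (R := R) t M) {P : PrimeSpectrum R} {m : M} (hm : AssElt P.asIdeal m) :
    Order.coheight P = t :=
  le_antisymm (h.dim P (hm.mem_support le_rfl)) (h.le_coheight hm)

theorem Good.exists_isSMulRegular [IsNoetherianRing R] {t : ℕ} [Module.Finite R M]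
    (h : Good (R := R) t M) {J : Ideal R}
    (hJ : ∀ P : PrimeSpectrum R, J ≤ P.asIdeal → Order.coheight P < t) :
    ∃ x ∈ J, IsSMulRegular M x :=
  exists_isSMulRegular_mem J fun P _ hy hle => (hJ P hle).ne (h.coheight_eq hy)

theorem Good.exists_ext_equiv [IsNoetherianRing R] {I : Ideal R} {d : ℕ}
    (hd : ∀ P : PrimeSpectrum R, I ≤ P.asIdeal → Order.coheight P ≤ d) (c : ℕ) :
    ∀ {M : Type u} [AddCommGroup M] [Module R M] [Module.Finite R M]
      (_ : Good (R := R) (d + c) M),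
    ∃ M' : ModuleCat.{u} R, Module.Finite R M' ∧ Good (R := R) d M' ∧
      (∀ P ∈ Module.support R M, I ≤ P.asIdeal → P ∈ Module.support R M') ∧
      (∀ i < c, Subsingleton (ExtM R i (ModuleCat.of R (R ⧸ I)) (ModuleCat.of R M))) ∧
      Nonempty (ExtM R c (ModuleCat.of R (R ⧸ I)) (ModuleCat.of R M) ≃ₗ[R]
        (R ⧸ I →ₗ[R] M')) := by
  induction c with
  | zero =>
    intro M _ _ _ h
    exact ⟨ModuleCat.of R M, ‹_›, h, fun P hP _ => hP, by simp, nonempty_ext_zero _ _⟩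
  | succ c ih =>
    intro M _ _ _ h
    obtain ⟨x, hxI, hx⟩ := h.exists_isSMulRegular (J := I) fun P hP =>
      (hd P hP).trans_lt (by norm_cast; lia)
    obtain ⟨M', hfin, hg, hsupp, hvan, ⟨e⟩⟩ := ih (h.quotSMulTop (t := d + c) hx)
    have hkill : ∀ a : R ⧸ I, x • a = 0 := fun a => by
      obtain ⟨a, rfl⟩ := Submodule.Quotient.mk_surjective _ a
      rw [← Submodule.Quotient.mk_smul, Submodule.Quotient.mk_eq_zero]
      exact I.mul_mem_right _ hxI
    have hvan' : ∀ i < c + 1,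
        Subsingleton (ExtM R i (ModuleCat.of R (R ⧸ I)) (ModuleCat.of R M)) := by
      intro i hi
      cases i with
      | zero =>
        obtain ⟨e⟩ := nonempty_ext_zero (ModuleCat.of R (R ⧸ I)) (ModuleCat.of R M)
        refine @Function.Injective.subsingleton _ _ _ e.injective ⟨fun f g => ?_⟩
        refine LinearMap.ext fun a => hx ?_
        change x • f a = x • g a
        rw [← map_smul, ← map_smul]
        refine (congrArg f (hkill a)).trans (Eq.trans ?_ (congrArg g (hkill a)).symm)
        rw [map_zero, map_zero]
      | succ i =>
        obtain ⟨δ, -, hδ⟩ := exists_ext_delta (ModuleCat.of R (R ⧸ I)) (ModuleCat.of R M) x hx i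
        have := hvan i (by lia)
        exact (hδ hkill).subsingleton
    obtain ⟨δ, hδi, hδ⟩ := exists_ext_delta (ModuleCat.of R (R ⧸ I)) (ModuleCat.of R M) x hx c
    refine ⟨M', hfin, hg, fun P hP hIP => hsupp P ?_ hIP, hvan',
      ⟨(LinearEquiv.ofBijective δ ⟨hδi (hvan' c (by lia)), hδ hkill⟩).symm.trans e⟩⟩
    rw [Module.support_quotSMulTop]
    exact ⟨hP, by simpa using hIP hxI⟩

end Good

section Length

variable {C : Type*} [CommRing C] {X Y Z : Type*} [AddCommGroup X] [Module C X]
  [AddCommGroup Y] [Module C Y] [AddCommGroup Z] [Module C Z]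

theorem length_quotSMulTop_pow {x : C} (hx : IsSMulRegular X x) (j : ℕ) :
    Module.length C (QuotSMulTop (x ^ j) X) = j * Module.length C (QuotSMulTop x X) := by
  induction j with
  | zero =>
    have : Subsingleton (QuotSMulTop (x ^ 0) X) := by
      refine subsingleton_of_forall_eq 0 fun y => ?_
      obtain ⟨y, rfl⟩ := Submodule.Quotient.mk_surjective _ y
      exact quotSMulTop_mk_eq_zero_iff.2 ⟨y, by simp⟩
    simp [Module.length_eq_zero]
  | succ j ih =>
    let f : QuotSMulTop (x ^ j) X →ₗ[C] QuotSMulTop (x ^ (j + 1)) X :=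
      Submodule.liftQ _ ((Submodule.mkQ _).comp (LinearMap.lsmul C X x)) <| by
        intro u hu
        obtain ⟨w, hw⟩ := quotSMulTop_mk_eq_zero_iff.1 ((Submodule.Quotient.mk_eq_zero _).2 hu)
        exact quotSMulTop_mk_eq_zero_iff.2 ⟨w, by
          rw [← hw, pow_succ', mul_smul, LinearMap.lsmul_apply]⟩
    let g : QuotSMulTop (x ^ (j + 1)) X →ₗ[C] QuotSMulTop x X :=
      Submodule.liftQ _ (Submodule.mkQ _) <| by
        intro u hu
        obtain ⟨w, hw⟩ := quotSMulTop_mk_eq_zero_iff.1 ((Submodule.Quotient.mk_eq_zero _).2 hu)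
        exact quotSMulTop_mk_eq_zero_iff.2 ⟨x ^ j • w, by rw [← hw, pow_succ', mul_smul]⟩
    have hf : Function.Injective f := by
      rw [injective_iff_map_eq_zero]
      intro u hu
      obtain ⟨u, rfl⟩ := Submodule.Quotient.mk_surjective _ u
      obtain ⟨w, hw⟩ := quotSMulTop_mk_eq_zero_iff.1 hu
      refine quotSMulTop_mk_eq_zero_iff.2 ⟨w, hx ?_⟩
      simpa [pow_succ', mul_smul] using hw
    have hg : Function.Surjective g := by
      intro u
      obtain ⟨u, rfl⟩ := Submodule.Quotient.mk_surjective _ u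
      exact ⟨Submodule.Quotient.mk u, rfl⟩
    have hex : Function.Exact f g := by
      intro u
      obtain ⟨u, rfl⟩ := Submodule.Quotient.mk_surjective _ u
      constructor
      · intro h
        obtain ⟨w, hw⟩ := quotSMulTop_mk_eq_zero_iff.1 h
        exact ⟨Submodule.Quotient.mk w, congrArg Submodule.Quotient.mk hw⟩
      · rintro ⟨v, hv⟩
        obtain ⟨v, rfl⟩ := Submodule.Quotient.mk_surjective _ v
        rw [← hv]
        exact quotSMulTop_mk_eq_zero_iff.2 ⟨v, rfl⟩
    rw [Module.length_eq_add_of_exact f g hf hg hex, ih]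
    push_cast
    ring

theorem length_le_add_of_ker_le_range (f : X →ₗ[C] Y) (g : Y →ₗ[C] Z)
    (h : LinearMap.ker g ≤ LinearMap.range f) :
    Module.length C Y ≤ Module.length C X + Module.length C Z := by
  rw [Module.length_eq_add_of_exact (LinearMap.ker g).subtype g.rangeRestrict
    (Submodule.subtype_injective _) g.surjective_rangeRestrict (fun y => by
      simp [LinearMap.rangeRestrict, Subtype.ext_iff])]
  refine add_le_add ((Module.length_le_of_injective (Submodule.inclusion h)
    (Submodule.inclusion_injective h)).trans
    (Module.length_le_of_surjective f.rangeRestrict f.surjective_rangeRestrict))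
    (Module.length_le_of_injective (LinearMap.range g).subtype (Submodule.subtype_injective _))

/-- Comparison of the multiplicities of a module and of a submodule of bounded colength. -/
theorem mul_length_quotSMulTop_le {x : C} (hX : IsSMulRegular X x) (hY : IsSMulRegular Y x)
    (g : X →ₗ[C] Y) (hg : Function.Injective g) (T : ℕ)
    (hT : ∀ y : Y, ∃ u : X, g u = x ^ T • y) (j : ℕ) :
    j * Module.length C (QuotSMulTop x X) ≤ (j + T) * Module.length C (QuotSMulTop x Y) := by
  have e := length_quotSMulTop_pow hY (j + T)
  push_cast at e
  rw [← length_quotSMulTop_pow hX, ← e]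
  let L : Submodule C Y := LinearMap.range (g ∘ₗ LinearMap.lsmul C X (x ^ j))
  let φ : QuotSMulTop (x ^ j) X →ₗ[C] Y ⧸ L := Submodule.liftQ _ (L.mkQ ∘ₗ g) <| by
    intro u hu
    obtain ⟨w, rfl⟩ := quotSMulTop_mk_eq_zero_iff.1 ((Submodule.Quotient.mk_eq_zero _).2 hu)
    exact (Submodule.Quotient.mk_eq_zero _).2 ⟨w, rfl⟩
  let ψ : QuotSMulTop (x ^ (j + T)) Y →ₗ[C] Y ⧸ L := Submodule.liftQ _ L.mkQ <| by
    intro u hu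
    obtain ⟨w, rfl⟩ := quotSMulTop_mk_eq_zero_iff.1 ((Submodule.Quotient.mk_eq_zero _).2 hu)
    obtain ⟨v, hv⟩ := hT w
    exact (Submodule.Quotient.mk_eq_zero _).2 ⟨v, by simp [hv, pow_add, mul_smul]⟩
  have hφ : Function.Injective φ := by
    rw [injective_iff_map_eq_zero]
    intro u hu
    obtain ⟨u, rfl⟩ := Submodule.Quotient.mk_surjective _ u
    obtain ⟨w, hw⟩ := (Submodule.Quotient.mk_eq_zero _).1 hu
    exact quotSMulTop_mk_eq_zero_iff.2 ⟨w, hg hw⟩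
  have hψ : Function.Surjective ψ := by
    intro u
    obtain ⟨u, rfl⟩ := Submodule.Quotient.mk_surjective _ u
    exact ⟨Submodule.Quotient.mk u, rfl⟩
  exact (Module.length_le_of_injective φ hφ).trans (Module.length_le_of_surjective ψ hψ)

variable [IsLocalRing C]

theorem assElt_maximalIdeal_of_ne_zero {v : X} (h : ∀ r ∈ maximalIdeal C, r • v = 0)
    (hv : v ≠ 0) : AssElt (maximalIdeal C) v := fun r => by
  refine ⟨fun hr => ?_, h r⟩
  by_contra hrm
  have := (notMem_maximalIdeal.1 hrm).smul_eq_zero.1 hr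
  exact hv this

theorem length_hom_le_one_of_isSimpleModule [IsSimpleModule C X]
    (h : Unif Y (maximalIdeal C)) : Module.length C (X →ₗ[C] Y) ≤ 1 := by
  rcases subsingleton_or_nontrivial (X →ₗ[C] Y) with hs | hs
  · simp [Module.length_eq_zero]
  have hX := IsSimpleModule.nontrivial C X
  obtain ⟨u, hu⟩ := exists_ne (0 : X)
  have hgen := IsSimpleModule.toSpanSingleton_surjective C hu
  have hann : ∀ r ∈ maximalIdeal C, r • u = 0 := by
    intro r hr
    by_contra hne
    obtain ⟨s, hs⟩ := IsSimpleModule.toSpanSingleton_surjective C hne u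
    rw [LinearMap.toSpanSingleton_apply, smul_smul] at hs
    have h1 : (1 - s * r) • u = 0 := by rw [sub_smul, one_smul, hs, sub_self]
    have h2 : IsUnit (1 - s * r) := by
      refine (isUnit_or_isUnit_one_sub_self (s * r)).resolve_left fun h3 => ?_
      exact (mem_maximalIdeal _).1 (Ideal.mul_mem_left _ s hr) h3
    exact hu (h2.smul_eq_zero.1 h1)
  have hass (f : X →ₗ[C] Y) (hf : f ≠ 0) : AssElt (maximalIdeal C) (f u) := by
    refine assElt_maximalIdeal_of_ne_zero (fun r hr => by rw [← map_smul, hann r hr, map_zero]) ?_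
    intro h0
    refine hf (LinearMap.ext fun v => ?_)
    obtain ⟨s, rfl⟩ := hgen v
    simp [h0]
  refine (Module.length_eq_one_iff.2 ?_).le
  rw [isSimpleModule_iff_toSpanSingleton_surjective]
  refine ⟨hs, fun f hf g => ?_⟩
  by_cases hg : g = 0
  · exact ⟨0, by simp [hg]⟩
  obtain ⟨r, s, hrs, hne⟩ := h _ _ (hass f hf) (hass g hg)
  have hsu : IsUnit s := by
    by_contra hs
    exact hne (hrs.trans (((hass g hg) s).2 ((mem_maximalIdeal _).2 hs)))
  obtain ⟨s, rfl⟩ := hsu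
  refine ⟨↑s⁻¹ * r, LinearMap.ext fun v => ?_⟩
  obtain ⟨t, rfl⟩ := hgen v
  simp only [LinearMap.toSpanSingleton_apply, LinearMap.smul_apply, map_smul, mul_smul]
  rw [hrs, smul_smul (↑s⁻¹ : C), Units.inv_mul, one_smul]

theorem length_hom_le (h : Unif Y (maximalIdeal C)) (hX : IsFiniteLength C X) :
    Module.length C (X →ₗ[C] Y) ≤ Module.length C X := by
  induction hX with
  | of_subsingleton =>
    rw [Module.length_eq_zero_iff.2]
    · exact zero_le
    · infer_instance
  | @of_simple_quotient X _ _ N _ _ ih =>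
    rw [Module.length_eq_add_of_exact N.subtype N.mkQ N.injective_subtype N.mkQ_surjective
      (LinearMap.exact_subtype_mkQ N), add_comm]
    refine (length_le_add_of_ker_le_range (LinearMap.lcomp C Y N.mkQ)
      (LinearMap.lcomp C Y N.subtype) ?_).trans (add_le_add ?_ ih)
    · intro f hf
      have hf' : ∀ u ∈ N, f u = 0 := fun u hu => LinearMap.congr_fun hf ⟨u, hu⟩
      exact ⟨N.liftQ f hf', LinearMap.ext fun u => rfl⟩
    · rw [Module.length_eq_one (R := C) (M := X ⧸ N)]
      exact length_hom_le_one_of_isSimpleModule h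

end Length

section Descent

theorem isFiniteLength_quotient {C : Type*} [CommRing C] [IsNoetherianRing C] [IsLocalRing C]
    (J : Ideal C) (hJ : ∀ Q : Ideal C, Q.IsPrime → J ≤ Q → Q = maximalIdeal C) :
    IsFiniteLength C (C ⧸ J) := by
  have h0 : Ring.KrullDimLE 0 (C ⧸ J) := .mk₀ fun Q hQ => by
    have h1 := hJ (Q.comap (Ideal.Quotient.mk J)) inferInstance fun r hr => by
      rw [Ideal.mem_comap, Ideal.Quotient.eq_zero_iff_mem.2 hr]
      exact Q.zero_mem
    have h2 : (Q.comap (Ideal.Quotient.mk J)).IsMaximal := h1 ▸ inferInstance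
    rw [← Ideal.map_comap_of_surjective _ Ideal.Quotient.mk_surjective Q]
    refine (Ideal.map_eq_top_or_isMaximal_of_surjective _ Ideal.Quotient.mk_surjective
      h2).resolve_left ?_
    rw [Ideal.map_comap_of_surjective _ Ideal.Quotient.mk_surjective Q]
    exact hQ.ne_top
  have h1 : IsArtinianRing (C ⧸ J) := isArtinianRing_iff_krullDimLE_zero.2 h0
  rw [← Module.length_ne_top_iff,
    Module.length_eq_of_surjective (R := C ⧸ J) (M := C ⧸ J) Ideal.Quotient.mk_surjective]
  exact Module.length_ne_top

/-- Uniformity at the maximal ideal of `M / x M` descends to uniformity of `M` at a prime of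
dimension one. -/
theorem Unif.of_map_local {C : Type*} [CommRing C] [IsLocalRing C] [IsNoetherianRing C]
    {M : Type*} [AddCommGroup M] [Module C M] [Module.Finite C M] {M' : Type*} [AddCommGroup M']
    [Module C M'] (π : M →ₗ[C] M') {x : C} (hx : IsSMulRegular M x)
    (hπ : ∀ w, π w = 0 ↔ ∃ v, x • v = w) {P : Ideal C} [hP : P.IsPrime] (hxP : x ∉ P)
    (hxm : x ∈ maximalIdeal C)
    (hmin : ∀ Q : Ideal C, Q.IsPrime → P ≤ Q → x ∈ Q → Q = maximalIdeal C)
    (h : Unif M' (maximalIdeal C)) : Unif M P := by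
  intro a b ha hb
  by_contra! hcon
  let ga : (C ⧸ P) →ₗ[C] M := Submodule.liftQ P (LinearMap.toSpanSingleton C M a)
    fun r hr => (ha r).2 hr
  let gb : (C ⧸ P) →ₗ[C] M := Submodule.liftQ P (LinearMap.toSpanSingleton C M b)
    fun r hr => (hb r).2 hr
  let g₀ : (C ⧸ P) × (C ⧸ P) →ₗ[C] M := ga.coprod gb
  have hg₀ : Function.Injective g₀ := by
    rw [injective_iff_map_eq_zero]
    rintro ⟨u, v⟩ huv
    obtain ⟨u, rfl⟩ := Submodule.Quotient.mk_surjective _ u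
    obtain ⟨v, rfl⟩ := Submodule.Quotient.mk_surjective _ v
    have h1 : u • a + v • b = 0 := huv
    have h2 : u • a = 0 := hcon u (-v) (by rw [neg_smul, eq_neg_of_add_eq_zero_left h1])
    have h3 : v • b = 0 := by rwa [h2, zero_add] at h1
    rw [Prod.mk_eq_zero, Submodule.Quotient.mk_eq_zero, Submodule.Quotient.mk_eq_zero]
    exact ⟨(ha u).1 h2, (hb v).1 h3⟩
  have hPg (p : C) (hp : p ∈ P) (z) : p • g₀ z = 0 := by
    obtain ⟨u, v⟩ := z
    obtain ⟨u, rfl⟩ := Submodule.Quotient.mk_surjective _ u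
    obtain ⟨v, rfl⟩ := Submodule.Quotient.mk_surjective _ v
    change p • (u • a + v • b) = 0
    rw [smul_add, smul_comm p, smul_comm p, (ha p).2 hp, (hb p).2 hp, smul_zero, smul_zero,
      add_zero]
  let F : ℕ →o Submodule C M :=
    { toFun := fun t => (LinearMap.range g₀).comap (LinearMap.lsmul C M (x ^ t))
      monotone' := monotone_nat_of_le_succ fun t w hw => by
        simp only [Submodule.mem_comap, LinearMap.lsmul_apply] at hw ⊢
        rw [pow_succ', mul_smul]
        exact Submodule.smul_mem _ _ hw }
  obtain ⟨T, hT⟩ := monotone_stabilizes_iff_noetherian.2 (inferInstance : IsNoetherian C M) F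
  let N := F T
  have hmemN (w : M) : w ∈ N ↔ ∃ z, g₀ z = x ^ T • w := Iff.rfl
  have hxN (w : M) (hw : x • w ∈ N) : w ∈ N := by
    have h1 : w ∈ F (T + 1) := by
      obtain ⟨z, hz⟩ := (hmemN _).1 hw
      exact ⟨z, by rw [hz, LinearMap.lsmul_apply, pow_succ, mul_smul]⟩
    rwa [← hT (T + 1) (by lia)] at h1
  have hPN (p : C) (hp : p ∈ P) (w : M) (hw : w ∈ N) : p • w = 0 := by
    obtain ⟨z, hz⟩ := (hmemN _).1 hw
    have hxT : IsSMulRegular M (x ^ T) := hx.pow T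
    refine hxT ?_
    change x ^ T • p • w = x ^ T • 0
    rw [smul_comm, ← hz, hPg p hp, smul_zero]
  let g : (C ⧸ P) × (C ⧸ P) →ₗ[C] N := g₀.codRestrict N fun z =>
    (hmemN _).2 ⟨x ^ T • z, map_smul _ _ _⟩
  have hg : Function.Injective g := fun z z' hz => hg₀ (congrArg Subtype.val hz)
  let J : Ideal C := P ⊔ Ideal.span {x}
  have hJm : J ≤ maximalIdeal C :=
    sup_le (le_maximalIdeal hP.ne_top) ((Ideal.span_singleton_le_iff_mem _).2 hxm)
  have hfl : IsFiniteLength C (C ⧸ J) := isFiniteLength_quotient J fun Q hQ hJQ =>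
    hmin Q hQ (le_sup_left.trans hJQ)
      ((Ideal.span_singleton_le_iff_mem _).1 (le_sup_right.trans hJQ))
  have hxD : IsSMulRegular ((C ⧸ P) × (C ⧸ P)) x := by
    have : IsSMulRegular (C ⧸ P) x := by
      rw [isSMulRegular_iff_right_eq_zero_of_smul]
      intro u hu
      obtain ⟨u, rfl⟩ := Submodule.Quotient.mk_surjective _ u
      rw [← Submodule.Quotient.mk_smul, Submodule.Quotient.mk_eq_zero] at hu
      rw [Submodule.Quotient.mk_eq_zero]
      exact (hP.mem_or_mem hu).resolve_left hxP
    intro z z' hz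
    exact Prod.ext (this (congrArg Prod.fst hz)) (this (congrArg Prod.snd hz))
  have hxNreg : IsSMulRegular N x := fun z z' hz => Subtype.ext (hx (congrArg Subtype.val hz))
  have key := mul_length_quotSMulTop_le hxD hxNreg g hg T
    (fun y => by
      obtain ⟨z, hz⟩ := (hmemN _).1 y.2
      exact ⟨z, Subtype.ext hz⟩) (T + 1)
  have hlow : Module.length C (C ⧸ J) + Module.length C (C ⧸ J) ≤
      Module.length C (QuotSMulTop x ((C ⧸ P) × (C ⧸ P))) := by
    rw [← Module.length_prod]
    let q : (C ⧸ P) →ₗ[C] (C ⧸ J) := Submodule.factor le_sup_left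
    have hxq (u : C ⧸ J) : x • u = 0 := by
      obtain ⟨u, rfl⟩ := Submodule.Quotient.mk_surjective _ u
      rw [← Submodule.Quotient.mk_smul, Submodule.Quotient.mk_eq_zero]
      exact Ideal.mul_mem_right _ _ ((le_sup_right : _ ≤ J) (Ideal.mem_span_singleton_self x))
    let q' : QuotSMulTop x ((C ⧸ P) × (C ⧸ P)) →ₗ[C] (C ⧸ J) × (C ⧸ J) :=
      Submodule.liftQ _ (q.prodMap q) <| by
        intro u hu
        obtain ⟨w, rfl⟩ :=
          quotSMulTop_mk_eq_zero_iff.1 ((Submodule.Quotient.mk_eq_zero _).2 hu)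
        rw [LinearMap.mem_ker, map_smul]
        exact Prod.ext (hxq _) (hxq _)
    refine Module.length_le_of_surjective q' ?_
    rintro ⟨u, v⟩
    obtain ⟨u, rfl⟩ := Submodule.Quotient.mk_surjective _ u
    obtain ⟨v, rfl⟩ := Submodule.Quotient.mk_surjective _ v
    exact ⟨Submodule.Quotient.mk (Submodule.Quotient.mk u, Submodule.Quotient.mk v), rfl⟩
  have hup : Module.length C (QuotSMulTop x N) ≤ Module.length C (C ⧸ J) := by
    refine le_trans ?_ (length_hom_le h hfl)
    let ev : ((C ⧸ J) →ₗ[C] M') →ₗ[C] M' := LinearMap.applyₗ (Submodule.Quotient.mk 1)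
    let πN : QuotSMulTop x N →ₗ[C] M' := Submodule.liftQ _ (π ∘ₗ N.subtype) <| by
      intro u hu
      obtain ⟨w, rfl⟩ := quotSMulTop_mk_eq_zero_iff.1 ((Submodule.Quotient.mk_eq_zero _).2 hu)
      exact (hπ _).2 ⟨w, rfl⟩
    have hπN : Function.Injective πN := by
      rw [injective_iff_map_eq_zero]
      intro u hu
      obtain ⟨u, rfl⟩ := Submodule.Quotient.mk_surjective _ u
      obtain ⟨v, hv⟩ := (hπ _).1 hu
      exact quotSMulTop_mk_eq_zero_iff.2 ⟨⟨v, hxN v (hv ▸ u.2)⟩, Subtype.ext hv⟩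
    have hrange : ∀ u, πN u ∈ LinearMap.range ev := by
      intro u
      obtain ⟨u, rfl⟩ := Submodule.Quotient.mk_surjective _ u
      refine ⟨Submodule.liftQ J (LinearMap.toSpanSingleton C M' (π u)) ?_, one_smul C (π u)⟩
      refine sup_le (fun r hr => ?_) ((Ideal.span_singleton_le_iff_mem _).2 ?_)
      · change r • π u = 0
        rw [← map_smul, hPN r hr _ u.2, map_zero]
      · change x • π u = 0
        rw [← map_smul]
        exact (hπ _).2 ⟨u, rfl⟩
    exact (Module.length_le_of_injective (πN.codRestrict _ hrange)
      fun z z' hz => hπN (congrArg Subtype.val hz)).trans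
      (Module.length_le_of_surjective ev.rangeRestrict ev.surjective_rangeRestrict)
  have hfin := Module.length_ne_top_iff.2 hfl
  have hpos : 0 < Module.length C (C ⧸ J) := by
    have : Nontrivial (C ⧸ J) :=
      Ideal.Quotient.nontrivial_iff.2 fun hJ => Ideal.IsPrime.ne_top' (top_le_iff.1 (hJ ▸ hJm))
    exact Module.length_pos
  have h2 : (((T + 1 : ℕ) : ℕ∞) * (Module.length C (C ⧸ J) + Module.length C (C ⧸ J))) ≤
      ((T + 1 : ℕ) + T) * Module.length C (C ⧸ J) :=
    (mul_le_mul_right hlow _).trans (key.trans (mul_le_mul_right hup _))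
  generalize Module.length C (C ⧸ J) = l at hfin hpos h2
  lift l to ℕ using hfin
  norm_cast at h2 hpos
  nlinarith

end Descent

section Localization

variable {R : Type*} [CommRing R] {Q : Ideal R} [hQ : Q.IsPrime]
  {C : Type*} [CommRing C] [Algebra R C] [IsLocalization.AtPrime C Q]
  {X X' : Type*} [AddCommGroup X] [Module R X] [AddCommGroup X'] [Module R X'] [Module C X']
  [IsScalarTower R C X'] (f : X →ₗ[R] X') [IsLocalizedModule Q.primeCompl f]

theorem smul_eq_zero_of_mul_algebraMap_eq {c : C} {r s : R} (hs : s ∉ Q)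
    (h : c * algebraMap R C s = algebraMap R C r) (y : X') : c • y = 0 ↔ r • y = 0 := by
  rw [← algebraMap_smul C r y, ← h, mul_comm, mul_smul]
  exact ((IsLocalization.map_units C (⟨s, hs⟩ : Q.primeCompl)).smul_eq_zero).symm

theorem smul_localized_eq_zero_iff {α : X} {r : R} :
    r • f α = 0 ↔ ∃ u ∉ Q, (u * r) • α = 0 := by
  rw [← map_smul, IsLocalizedModule.eq_zero_iff Q.primeCompl f]
  simp only [mul_smul]
  exact ⟨fun ⟨u, hu⟩ => ⟨u, u.2, hu⟩, fun ⟨u, hu, h⟩ => ⟨⟨u, hu⟩, h⟩⟩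

theorem map_isPrime_of_le {P : Ideal R} [hP : P.IsPrime] (hPQ : P ≤ Q) :
    (P.map (algebraMap R C)).IsPrime :=
  IsLocalization.isPrime_of_isPrime_disjoint Q.primeCompl C P hP
    (Set.disjoint_left.2 fun _ hu hu' => hu (hPQ hu'))

theorem mem_map_algebraMap_iff {P : Ideal R} [hP : P.IsPrime] (hPQ : P ≤ Q) {c : C} {r s : R}
    (hs : s ∉ Q) (h : c * algebraMap R C s = algebraMap R C r) :
    c ∈ P.map (algebraMap R C) ↔ r ∈ P := by
  have hdisj : Disjoint (Q.primeCompl : Set R) (P : Set R) :=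
    Set.disjoint_left.2 fun u hu hu' => hu (hPQ hu')
  rw [← Ideal.mul_unit_mem_iff_mem _ (IsLocalization.map_units C (⟨s, hs⟩ : Q.primeCompl)), h]
  conv_rhs => rw [← IsLocalization.under_map_of_isPrime_disjoint Q.primeCompl C hP hdisj]
  rfl

theorem AssElt.localized {P : Ideal R} [hP : P.IsPrime] (hPQ : P ≤ Q) {α : X}
    (h : AssElt P α) : AssElt (P.map (algebraMap R C)) (f α) := by
  intro c
  obtain ⟨⟨r, s⟩, hrs⟩ := IsLocalization.surj Q.primeCompl c
  rw [smul_eq_zero_of_mul_algebraMap_eq s.2 hrs, mem_map_algebraMap_iff hPQ s.2 hrs,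
    smul_localized_eq_zero_iff (Q := Q) f]
  constructor
  · rintro ⟨u, hu, h1⟩
    exact (hP.mem_or_mem ((h _).1 h1)).resolve_left fun h2 => hu (hPQ h2)
  · intro hr
    exact ⟨1, hQ.one_notMem, (h _).2 (P.mul_mem_left _ hr)⟩

theorem exists_assElt_of_localized [IsNoetherianRing R] {y : X'}
    (hy : AssElt (Q.map (algebraMap R C)) y) : ∃ α : X, AssElt Q α ∧ ∃ s : R, f α = s • y := by
  obtain ⟨⟨α, s⟩, hα⟩ := IsLocalizedModule.surj Q.primeCompl f y
  obtain ⟨J, ⟨u, rfl⟩, hmax⟩ := WellFounded.has_min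
    (wellFounded_gt : WellFounded ((· > ·) : Ideal R → Ideal R → Prop))
    (Set.range fun u : Q.primeCompl => LinearMap.ker (LinearMap.toSpanSingleton R X (u.1 • α)))
    (Set.range_nonempty _)
  have hα' : s.1 • y = f α := hα
  have hne : f α ≠ 0 := fun h0 => by
    rw [h0, ← algebraMap_smul C, (IsLocalization.map_units C s).smul_eq_zero] at hα'
    have := map_isPrime_of_le (C := C) (le_refl Q)
    exact hy.ne_zero hα'
  refine ⟨u.1 • α, fun r => ⟨fun hr => ?_, fun hr => ?_⟩, u.1 * s.1, ?_⟩
  · by_contra hrQ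
    refine hne ((IsLocalizedModule.eq_zero_iff Q.primeCompl f).2
      ⟨⟨r, hrQ⟩ * u, ?_⟩)
    change (r * u.1) • α = 0
    rw [mul_smul, hr]
  · have h1 : r • f α = 0 := by
      rw [← hα', smul_comm, ← algebraMap_smul C r y,
        (hy _).2 (Ideal.mem_map_of_mem _ hr), smul_zero]
    obtain ⟨v, hv, h2⟩ := (smul_localized_eq_zero_iff (Q := Q) f).1 h1
    have hle : LinearMap.ker (LinearMap.toSpanSingleton R X (u.1 • α)) ≤
        LinearMap.ker (LinearMap.toSpanSingleton R X ((u * ⟨v, hv⟩ : Q.primeCompl).1 • α)) := by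
      intro t ht
      have ht' : t • u.1 • α = 0 := ht
      change t • (u.1 * v) • α = 0
      rw [mul_comm, mul_smul, smul_comm, ht', smul_zero]
    have heq := eq_of_le_of_not_lt hle (hmax _ ⟨_, rfl⟩)
    have : r ∈ LinearMap.ker (LinearMap.toSpanSingleton R X
        ((u * ⟨v, hv⟩ : Q.primeCompl).1 • α)) := by
      change r • (u.1 * v) • α = 0
      rw [smul_smul, show r * (u.1 * v) = u.1 * (v * r) by ring, mul_smul, h2, smul_zero]
    rw [← heq] at this
    exact this
  · rw [map_smul, mul_smul, hα']

theorem Unif.localized (f : X →ₗ[R] X') [IsLocalizedModule Q.primeCompl f]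
    [IsNoetherianRing R] (h : Unif X Q) :
    Unif X' (Q.map (algebraMap R C)) := by
  intro y z hy hz
  obtain ⟨α, hα, s, hs⟩ := exists_assElt_of_localized f hy
  obtain ⟨β, hβ, t, ht⟩ := exists_assElt_of_localized f hz
  obtain ⟨a, b, hab, hne⟩ := h α β hα hβ
  have ha : a ∉ Q := fun ha => hne ((hα a).2 ha)
  have hp := map_isPrime_of_le (C := C) (le_refl Q)
  have h1 := ((hα.smul ha).localized (C := C) f le_rfl).ne_zero
  refine ⟨algebraMap R C (a * s), algebraMap R C (b * t), ?_, ?_⟩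
  · rw [algebraMap_smul, algebraMap_smul, mul_smul, mul_smul, ← hs, ← ht, ← map_smul, ← map_smul,
      hab]
  · rwa [algebraMap_smul, mul_smul, ← hs, ← map_smul]

theorem Unif.of_localized (f : X →ₗ[R] X') [IsLocalizedModule Q.primeCompl f]
    {P : Ideal R} [hP : P.IsPrime] (hPQ : P ≤ Q)
    (h : Unif X' (P.map (algebraMap R C))) : Unif X P := by
  intro α β hα hβ
  obtain ⟨c, d, hcd, hne⟩ := h _ _ (hα.localized f hPQ) (hβ.localized f hPQ)
  obtain ⟨⟨r, s⟩, hrs⟩ := IsLocalization.surj Q.primeCompl c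
  obtain ⟨⟨r', s'⟩, hrs'⟩ := IsLocalization.surj Q.primeCompl d
  have h1 : f ((s'.1 * r) • α) = f ((s.1 * r') • β) := by
    rw [map_smul, map_smul, ← algebraMap_smul C (s'.1 * r) (f α),
      ← algebraMap_smul C (s.1 * r') (f β), map_mul, map_mul, ← hrs, ← hrs']
    rw [show algebraMap R C s' * (c * algebraMap R C s) =
      (algebraMap R C s * algebraMap R C s') * c by ring,
      show algebraMap R C s * (d * algebraMap R C s') =
      (algebraMap R C s * algebraMap R C s') * d by ring, mul_smul, hcd, mul_smul (_ * _) d]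
  obtain ⟨u, hu⟩ := (IsLocalizedModule.eq_iff_exists Q.primeCompl f).1 h1
  refine ⟨u.1 * (s'.1 * r), u.1 * (s.1 * r'),
    by rw [mul_smul u.1, mul_smul u.1]; exact hu, fun h0 => ?_⟩
  refine hne ((smul_eq_zero_of_mul_algebraMap_eq s.2 hrs _).2
    ((smul_localized_eq_zero_iff (Q := Q) f).2 ⟨u.1 * s'.1, (u * s').2, ?_⟩))
  rw [mul_assoc]
  exact h0

end Localization

/-- Uniformity of `M / x M` at `Q` descends to uniformity of `M` at `P`, if `Q` is minimal over
`P + (x)`. -/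
theorem Unif.of_quotSMulTop {R : Type*} [CommRing R] [IsNoetherianRing R] {M : Type*}
    [AddCommGroup M] [Module R M] [Module.Finite R M] {x : R} (hx : IsSMulRegular M x)
    {P Q : PrimeSpectrum R} (hPQ : P ≤ Q) (hxP : x ∉ P.asIdeal) (hxQ : x ∈ Q.asIdeal)
    (hmin : ∀ q : PrimeSpectrum R, P ≤ q → q ≤ Q → x ∈ q.asIdeal → q = Q)
    (h : Unif (QuotSMulTop x M) Q.asIdeal) : Unif M P.asIdeal := by
  let C := Localization.AtPrime Q.asIdeal
  have : IsNoetherianRing C := IsLocalization.isNoetherianRing Q.asIdeal.primeCompl C inferInstance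
  let f := LocalizedModule.mkLinearMap Q.asIdeal.primeCompl M
  let f' := LocalizedModule.mkLinearMap Q.asIdeal.primeCompl (QuotSMulTop x M)
  refine Unif.of_localized (C := C) f hPQ ?_
  have h1 := h.localized (C := C) f'
  rw [IsLocalization.AtPrime.map_eq_maximalIdeal Q.asIdeal C] at h1
  have hdisj : Disjoint (Q.asIdeal.primeCompl : Set R) (P.asIdeal : Set R) :=
    Set.disjoint_left.2 fun u hu hu' => hu (hPQ hu')
  have hcomap := IsLocalization.under_map_of_isPrime_disjoint Q.asIdeal.primeCompl C P.2 hdisj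
  have hprime := IsLocalization.isPrime_of_isPrime_disjoint Q.asIdeal.primeCompl C P.asIdeal P.2
    hdisj
  let μ : M →ₗ[R] QuotSMulTop x M := Submodule.mkQ _
  refine Unif.of_map_local (LocalizedModule.map Q.asIdeal.primeCompl μ)
    (x := algebraMap R C x) ?_ ?_ ?_ ?_ ?_ h1
  · rw [isSMulRegular_iff_right_eq_zero_of_smul]
    intro y hy
    obtain ⟨⟨α, s⟩, hα⟩ := IsLocalizedModule.surj Q.asIdeal.primeCompl f y
    have hα' : s.1 • y = f α := hα
    rw [algebraMap_smul] at hy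
    have h2 : x • f α = 0 := by rw [← hα', smul_comm, hy, smul_zero]
    obtain ⟨u, hu, h3⟩ := (smul_localized_eq_zero_iff (Q := Q.asIdeal) f).1 h2
    have h4 : u • α = 0 := hx (by simpa [mul_smul, smul_comm x] using h3)
    have h5 : s.1 • y = 0 := by
      rw [hα']
      exact (IsLocalizedModule.eq_zero_iff Q.asIdeal.primeCompl f).2 ⟨⟨u, hu⟩, h4⟩
    rw [← algebraMap_smul C, (IsLocalization.map_units C s).smul_eq_zero] at h5
    exact h5
  · intro y
    have hex := LocalizedModule.map_exact Q.asIdeal.primeCompl (LinearMap.lsmul R M x) μ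
      (fun w => (quotSMulTop_mk_eq_zero_iff (y := w)).trans Iff.rfl)
    refine (hex y).trans (exists_congr fun v => ?_)
    rw [algebraMap_smul]
    refine Eq.congr_left ?_
    induction v using LocalizedModule.induction_on with
    | h m s =>
      rw [IsLocalizedModule.mk_eq_mk', IsLocalizedModule.map_mk', LinearMap.lsmul_apply,
        IsLocalizedModule.mk'_smul]
  · intro h2
    exact hxP (hcomap ▸ h2)
  · exact (IsLocalization.AtPrime.to_map_mem_maximal_iff C Q.asIdeal x).2 hxQ
  · intro q hq hPq hxq
    have h2 := hmin ⟨q.comap (algebraMap R C), inferInstance⟩ (fun r hr =>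
      hPq (Ideal.mem_map_of_mem _ hr)) (fun r hr => ?_) hxq
    · have h3 : q.comap (algebraMap R C) = Q.asIdeal := congrArg PrimeSpectrum.asIdeal h2
      rw [← IsLocalization.AtPrime.map_eq_maximalIdeal Q.asIdeal C]
      exact (IsLocalization.map_under Q.asIdeal.primeCompl C q).symm.trans
        (congrArg (Ideal.map (algebraMap R C)) h3)
    · exact (IsLocalization.AtPrime.to_map_mem_maximal_iff C Q.asIdeal r).1
        (le_maximalIdeal hq.ne_top hr)

/-- The associated primes of a module with `Good t M` are uniform: it has "multiplicity one"
at each of them. -/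
theorem Good.unif {R : Type u} [CommRing R] [IsLocalRing R] [IsNoetherianRing R] {t : ℕ} :
    ∀ {M : Type u} [AddCommGroup M] [Module R M] [Module.Finite R M],
      Good (R := R) t M → ∀ P : PrimeSpectrum R, Unif M P.asIdeal := by
  induction t with
  | zero =>
    intro M _ _ _ h P a b ha hb
    have hP : P.asIdeal = maximalIdeal R := by
      have h0 : IsMax P := Order.coheight_eq_zero.1 (by simpa using h.coheight_eq ha)
      rw [h0.eq_of_le (b := closedPoint R) (le_maximalIdeal P.2.ne_top)]
      rfl
    rw [hP] at ha hb
    obtain ⟨e⟩ := nonempty_ext_zero (ModuleCat.of R (R ⧸ maximalIdeal R)) (ModuleCat.of R M)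
    obtain ⟨f, hf⟩ := h.top
    have key : ∀ x : M, AssElt (maximalIdeal R) x →
        ∃ φ : (R ⧸ maximalIdeal R) →ₗ[R] M, φ 1 = x := fun x hx =>
      ⟨Submodule.liftQ _ (LinearMap.toSpanSingleton R M x)
        (fun r hr => by simpa using (hx r).2 hr),
        (Submodule.liftQ_apply _ _ (1 : R)).trans (one_smul R x)⟩
    obtain ⟨φ, hφ⟩ := key a ha
    obtain ⟨ψ, hψ⟩ := key b hb
    obtain ⟨u, hu⟩ := Submodule.Quotient.mk_surjective _ (f (e.symm φ))
    obtain ⟨v, hv⟩ := Submodule.Quotient.mk_surjective _ (f (e.symm ψ))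
    have hvm : v ∉ maximalIdeal R := fun hvm => by
      rw [(Submodule.Quotient.mk_eq_zero _).2 hvm] at hv
      have h0 : ψ = 0 := by
        apply e.symm.injective
        apply hf
        rw [← hv]
        simp
      exact hb.ne_zero (by rw [← hψ, h0]; simp)
    refine ⟨v, u, ?_, fun h0 => hvm ((ha v).1 h0)⟩
    have h1 : v • φ = u • ψ := by
      apply e.symm.injective
      apply hf
      rw [map_smul, map_smul, map_smul, map_smul, ← hu, ← hv, ← Submodule.Quotient.mk_smul,
        ← Submodule.Quotient.mk_smul, smul_eq_mul, smul_eq_mul, mul_comm]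
    rw [← hφ, ← hψ]
    exact congrArg (fun g : (R ⧸ maximalIdeal R) →ₗ[R] M => g 1) h1
  | succ t ih =>
    intro M _ _ _ h P a b ha hb
    have hc := h.coheight_eq ha
    push_cast at hc
    obtain ⟨-, ⟨Q, hPQ, hQ⟩, -⟩ := Order.coheight_eq_coe_add_one_iff.1 hc
    obtain ⟨x, hxQ, hx⟩ := h.exists_isSMulRegular (J := Q.asIdeal) fun q hq => by
      refine (Order.coheight_anti (show Q ≤ q from hq)).trans_lt ?_
      rw [hQ]
      norm_cast
      lia
    refine Unif.of_quotSMulTop hx hPQ.le (ha.notMem_of_isSMulRegular hx) hxQ ?_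
      (ih (h.quotSMulTop hx) Q) a b ha hb
    intro q hPq hqQ hxq
    by_contra hne
    have h1 : P < q := lt_of_le_of_ne hPq fun h => ha.notMem_of_isSMulRegular hx (h ▸ hxq)
    have h2 := Order.coheight_add_one_le h1
    have h3 := Order.coheight_add_one_le (lt_of_le_of_ne hqQ hne)
    rw [hQ] at h3
    rw [hc] at h2
    have h4 := (add_le_add_left h3 1).trans h2
    norm_cast at h4
    lia

/-- The primes of coheight `d` containing `I`. -/
def primesOver {R : Type*} [CommRing R] (I : Ideal R) (d : ℕ) : Set (PrimeSpectrum R) :=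
  {p | I ≤ p.asIdeal ∧ Order.coheight p = d}

/-- Two primes are linked in coheight at least `d - 1` if some prime of such a coheight contains
both. -/
def Linked {R : Type*} [CommRing R] (d : ℕ) (p q : PrimeSpectrum R) : Prop :=
  ∃ P : PrimeSpectrum R, p ≤ P ∧ q ≤ P ∧ (d : ℕ∞) ≤ Order.coheight P + 1

theorem Linked.symm {R : Type*} [CommRing R] {d : ℕ} {p q : PrimeSpectrum R}
    (h : Linked d p q) : Linked d q p :=
  let ⟨P, hp, hq, hP⟩ := h
  ⟨P, hq, hp, hP⟩

theorem eq_of_le_of_coheight_le {R : Type*} [CommRing R] {p q : PrimeSpectrum R} {d : ℕ}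
    (hpq : p ≤ q) (hp : Order.coheight p ≤ d) (hq : d ≤ Order.coheight q) : p = q := by
  by_contra hne
  have h := (add_le_add_left hq 1).trans
    ((Order.coheight_add_one_le (lt_of_le_of_ne hpq hne)).trans hp)
  norm_cast at h
  lia

section Torsion

variable {R : Type u} [CommRing R] {M : Type u} [AddCommGroup M] [Module R M]

theorem exists_smul_eq_of_smul_eq_add {I : Ideal R} {K₁ K₂ : Submodule R M}
    (hinf : K₁ ⊓ K₂ = ⊥) (hsup : K₁ ⊔ K₂ = Submodule.torsionBySet R M I) {y : R}
    (hy : IsSMulRegular M y) {z v w : M} (hz : z ∈ K₁) (hv : v ∈ K₂) (h : y • w = z + v) :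
    ∃ w₁ ∈ K₁, y • w₁ = z := by
  have hw : w ∈ K₁ ⊔ K₂ := by
    rw [hsup, Submodule.mem_torsionBySet_iff]
    intro s
    have hzv : z + v ∈ Submodule.torsionBySet R M I := hsup ▸ Submodule.add_mem_sup hz hv
    refine hy ?_
    change y • (s : R) • w = y • (0 : M)
    rw [smul_comm, h, smul_zero]
    exact (Submodule.mem_torsionBySet_iff _ _).1 hzv s
  obtain ⟨w₁, hw₁, w₂, hw₂, rfl⟩ := Submodule.mem_sup.1 hw
  refine ⟨w₁, hw₁, ?_⟩
  rw [← sub_eq_zero, ← Submodule.mem_bot R, ← hinf]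
  refine ⟨sub_mem (K₁.smul_mem _ hw₁) hz, ?_⟩
  have : y • w₁ - z = v - y • w₂ := by
    rw [smul_add] at h
    rw [sub_eq_sub_iff_add_eq_add, h, add_comm]
  rw [this]
  exact sub_mem hv (K₂.smul_mem _ hw₂)

theorem assElt_or_assElt_of_add {K₁ K₂ : Submodule R M} (hinf : K₁ ⊓ K₂ = ⊥)
    {p : PrimeSpectrum R} {k₁ k₂ : M} (hk₁ : k₁ ∈ K₁) (hk₂ : k₂ ∈ K₂)
    (h : AssElt p.asIdeal (k₁ + k₂)) : AssElt p.asIdeal k₁ ∨ AssElt p.asIdeal k₂ := by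
  have key : ∀ r ∈ p.asIdeal, r • k₁ = 0 ∧ r • k₂ = 0 := by
    intro r hr
    have h0 := (h r).2 hr
    rw [smul_add] at h0
    have h1 : r • k₁ = 0 := by
      rw [← Submodule.mem_bot R, ← hinf]
      refine ⟨K₁.smul_mem _ hk₁, ?_⟩
      rw [eq_neg_of_add_eq_zero_left h0]
      exact K₂.neg_mem (K₂.smul_mem _ hk₂)
    exact ⟨h1, by rwa [h1, zero_add] at h0⟩
  by_contra! hcon
  obtain ⟨h₁, h₂⟩ := hcon
  have e₁ : ∃ r, r • k₁ = 0 ∧ r ∉ p.asIdeal := by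
    by_contra! hc
    exact h₁ fun r => ⟨hc r, fun hr => (key r hr).1⟩
  have e₂ : ∃ r, r • k₂ = 0 ∧ r ∉ p.asIdeal := by
    by_contra! hc
    exact h₂ fun r => ⟨hc r, fun hr => (key r hr).2⟩
  obtain ⟨r, hr, hrp⟩ := e₁
  obtain ⟨s, hs, hsp⟩ := e₂
  have : (r * s) • (k₁ + k₂) = 0 := by
    rw [smul_add, mul_smul, mul_smul, hs, smul_comm, hr, smul_zero, smul_zero, add_zero]
  exact (p.2.mem_or_mem ((h _).1 this)).elim hrp hsp

variable [IsNoetherianRing R] [Module.Finite R M]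

theorem exists_assElt_quotSMulTop_of_coheight {K : Submodule R M} {d : ℕ} {p P : PrimeSpectrum R}
    {k : M} (hk : AssElt p.asIdeal k) (hkK : k ∈ K) (hp : Order.coheight p ≤ d)
    (hpP : p ≤ P) (hP : (d : ℕ∞) ≤ Order.coheight P + 1) {y : R} (hy : IsSMulRegular M y)
    (hyP : y ∈ P.asIdeal) :
    ∃ z ∈ K, ∀ r : R, (∃ w ∈ K, y • w = r • z) ↔ r ∈ P.asIdeal := by
  have hyK : IsSMulRegular K y := fun a b hab => Subtype.ext (hy (congrArg Subtype.val hab))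
  obtain ⟨q, hpq, hqP, hyq, z, hz⟩ := exists_assElt_quotSMulTop (M := K) hyK
    (m := ⟨k, hkK⟩) (assElt_coe_iff.1 hk) hpP hyP
  have hlt : p < q := lt_of_le_of_ne hpq fun h => hk.notMem_of_isSMulRegular hy (h ▸ hyq)
  obtain rfl : q = P := by
    by_contra hne
    have h1 := (Order.coheight_add_one_le hlt).trans hp
    have h2 := hP.trans (Order.coheight_add_one_le (lt_of_le_of_ne hqP hne))
    have h3 := (add_le_add_left h2 1).trans h1
    norm_cast at h3
    lia
  refine ⟨z, z.2, fun r => ?_⟩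
  rw [← assElt_quotSMulTop_mk_iff.1 hz r]
  exact ⟨fun ⟨w, hw, h⟩ => ⟨⟨w, hw⟩, Subtype.ext h⟩, fun ⟨w, h⟩ => ⟨w, w.2, congrArg Subtype.val h⟩⟩

variable [IsLocalRing R]

theorem Good.not_linked {I : Ideal R} {d : ℕ} (hM : Good (R := R) d M) {K₁ K₂ : Submodule R M}
    (hinf : K₁ ⊓ K₂ = ⊥) (hsup : K₁ ⊔ K₂ = Submodule.torsionBySet R M I)
    {p q : PrimeSpectrum R} {k₁ k₂ : M} (hk₁ : AssElt p.asIdeal k₁) (hkK₁ : k₁ ∈ K₁)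
    (hk₂ : AssElt q.asIdeal k₂) (hkK₂ : k₂ ∈ K₂) : ¬ Linked d p q := by
  rintro ⟨P, hpP, hqP, hP⟩
  have hp := hM.coheight_eq hk₁
  have hq := hM.coheight_eq hk₂
  by_cases hPd : (d : ℕ∞) ≤ Order.coheight P
  · obtain rfl := eq_of_le_of_coheight_le hpP hp.le hPd
    obtain rfl := eq_of_le_of_coheight_le hqP hq.le hPd
    obtain ⟨r, s, hrs, hne⟩ := hM.unif _ k₁ k₂ hk₁ hk₂
    refine hne ((Submodule.mem_bot R).1 (hinf ▸ ⟨K₁.smul_mem _ hkK₁, ?_⟩))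
    rw [hrs]
    exact K₂.smul_mem _ hkK₂
  · rw [not_le] at hPd
    obtain ⟨t, rfl⟩ : ∃ t, d = t + 1 := Nat.exists_eq_succ_of_ne_zero (by rintro rfl; simp at hPd)
    obtain ⟨y, hyP, hy⟩ := hM.exists_isSMulRegular (J := P.asIdeal) fun P' hP' =>
      (Order.coheight_anti (show P ≤ P' from hP')).trans_lt hPd
    obtain ⟨z₁, hz₁, h₁⟩ := exists_assElt_quotSMulTop_of_coheight hk₁ hkK₁ hp.le hpP hP hy hyP
    obtain ⟨z₂, hz₂, h₂⟩ := exists_assElt_quotSMulTop_of_coheight hk₂ hkK₂ hq.le hqP hP hy hyP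
    have hm₁ : AssElt P.asIdeal (Submodule.Quotient.mk z₁ : QuotSMulTop y M) := by
      rw [assElt_quotSMulTop_mk_iff]
      intro r
      rw [← h₁]
      refine ⟨fun ⟨w, hw⟩ => ?_, fun ⟨w, _, hw⟩ => ⟨w, hw⟩⟩
      exact exists_smul_eq_of_smul_eq_add hinf hsup hy (K₁.smul_mem r hz₁) K₂.zero_mem
        (by rw [hw, add_zero])
    have hm₂ : AssElt P.asIdeal (Submodule.Quotient.mk z₂ : QuotSMulTop y M) := by
      rw [assElt_quotSMulTop_mk_iff]
      intro r
      rw [← h₂]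
      refine ⟨fun ⟨w, hw⟩ => ?_, fun ⟨w, _, hw⟩ => ⟨w, hw⟩⟩
      exact exists_smul_eq_of_smul_eq_add (inf_comm K₁ K₂ ▸ hinf) (sup_comm K₁ K₂ ▸ hsup) hy
        (K₂.smul_mem r hz₂) K₁.zero_mem (by rw [hw, add_zero])
    obtain ⟨r, s, hrs, hne⟩ := (hM.quotSMulTop hy).unif P _ _ hm₁ hm₂
    rw [← sub_eq_zero, ← Submodule.Quotient.mk_smul, ← Submodule.Quotient.mk_smul,
      ← Submodule.Quotient.mk_sub, quotSMulTop_mk_eq_zero_iff] at hrs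
    obtain ⟨w, hw⟩ := hrs
    obtain ⟨w₁, -, hw₁⟩ := exists_smul_eq_of_smul_eq_add hinf hsup hy (K₁.smul_mem r hz₁)
      (K₂.neg_mem (K₂.smul_mem s hz₂)) (hw.trans (sub_eq_add_neg _ _))
    rw [← Submodule.Quotient.mk_smul] at hne
    exact hne (quotSMulTop_mk_eq_zero_iff.2 ⟨w₁, hw₁⟩)

theorem Good.exists_assElt_of_mem_primesOver {I : Ideal R} {d : ℕ} (hM : Good (R := R) d M)
    (hsupp : primesOver I d ⊆ Module.support R M) {p : PrimeSpectrum R}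
    (hp : p ∈ primesOver I d) :
    ∃ k ∈ Submodule.torsionBySet R M I, AssElt p.asIdeal k := by
  obtain ⟨q, hq, y, hy⟩ := exists_assElt_le_of_mem_support (hsupp hp)
  obtain rfl := eq_of_le_of_coheight_le hq (hM.coheight_eq hy).le hp.2.ge
  exact ⟨y, (Submodule.mem_torsionBySet_iff _ _).2 fun r => (hy r).2 (hp.1 r.2), hy⟩

theorem Good.exists_mem_primesOver {I : Ideal R} {d : ℕ} (hM : Good (R := R) d M)
    {K : Submodule R M} (hK : K ≤ Submodule.torsionBySet R M I) (hne : K ≠ ⊥) :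
    ∃ p ∈ primesOver I d, ∃ k ∈ K, AssElt p.asIdeal k := by
  obtain ⟨x, hxK, hx⟩ := Submodule.exists_mem_ne_zero_of_ne_bot hne
  obtain ⟨p, s, hs⟩ := exists_assElt (R := R) hx
  refine ⟨p, ⟨fun r hr => ?_, hM.coheight_eq hs⟩, s • x, K.smul_mem _ hxK, hs⟩
  exact (hs r).1 ((Submodule.mem_torsionBySet_iff _ _).1 (hK (K.smul_mem s hxK)) ⟨r, hr⟩)

/-- A nontrivial decomposition of the `I`-torsion of `M` separates the primes of coheight `d`
over `I`. -/
theorem Good.exists_separation {I : Ideal R} {d : ℕ} (hM : Good (R := R) d M)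
    (hsupp : primesOver I d ⊆ Module.support R M) {K₁ K₂ : Submodule R M}
    (hinf : K₁ ⊓ K₂ = ⊥) (hsup : K₁ ⊔ K₂ = Submodule.torsionBySet R M I)
    (h₁ : K₁ ≠ ⊥) (h₂ : K₂ ≠ ⊥) :
    ∃ S : Set (PrimeSpectrum R), (primesOver I d ∩ S).Nonempty ∧ (primesOver I d \ S).Nonempty ∧
      ∀ p ∈ primesOver I d ∩ S, ∀ q ∈ primesOver I d \ S, ¬ Linked d p q := by
  obtain ⟨p, hp, k₁, hk₁, hpk⟩ := hM.exists_mem_primesOver (hsup ▸ le_sup_left) h₁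
  obtain ⟨q, hq, k₂, hk₂, hqk⟩ := hM.exists_mem_primesOver (hsup ▸ le_sup_right) h₂
  refine ⟨{p | ∃ k ∈ K₁, AssElt p.asIdeal k}, ⟨p, hp, k₁, hk₁, hpk⟩, ⟨q, hq, ?_⟩, ?_⟩
  · rintro ⟨k, hk, hqk'⟩
    exact hM.not_linked hinf hsup hqk' hk hqk hk₂ ⟨q, le_rfl, le_rfl, by rw [hq.2]; simp⟩
  · rintro p ⟨-, k, hk, hpk⟩ q ⟨hq, hqS⟩
    obtain ⟨x, hx, hqx⟩ := hM.exists_assElt_of_mem_primesOver hsupp hq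
    rw [← hsup] at hx
    obtain ⟨x₁, hx₁, x₂, hx₂, rfl⟩ := Submodule.mem_sup.1 hx
    obtain h | h := assElt_or_assElt_of_add hinf hx₁ hx₂ hqx
    · exact (hqS ⟨x₁, hx₁, h⟩).elim
    · exact hM.not_linked hinf hsup hpk hk h hx₂

end Torsion

section Decompose

variable {R : Type u} [CommRing R]

theorem exists_smul_eq_of_smul_eq_smul {N : Type*} [AddCommGroup N] [Module R N] {u v : R}
    (hv : IsSMulRegular (QuotSMulTop u N) v) {x y : N} (h : v • x = u • y) :
    ∃ w, u • w = x := by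
  rw [← quotSMulTop_mk_eq_zero_iff]
  refine hv ?_
  change v • (Submodule.Quotient.mk x : QuotSMulTop u N) = v • 0
  rw [smul_zero, ← Submodule.Quotient.mk_smul, quotSMulTop_mk_eq_zero_iff]
  exact ⟨y, h.symm⟩

theorem mem_torsionBySet_of_smul {N : Type*} [AddCommGroup N] [Module R N] {u : R}
    (hu : IsSMulRegular N u) {b : Set R} {w : N} (h : u • w ∈ Submodule.torsionBySet R N b) :
    w ∈ Submodule.torsionBySet R N b := by
  rw [Submodule.mem_torsionBySet_iff] at h ⊢
  intro r
  refine hu ?_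
  change u • (r : R) • w = u • (0 : N)
  rw [smul_comm, smul_zero]
  exact h r

variable [IsNoetherianRing R] [IsLocalRing R]
  {M : Type u} [AddCommGroup M] [Module R M] [Module.Finite R M]

theorem Good.isCompl_torsionBySet {I b₁ b₂ : Ideal R} {d : ℕ} (hM : Good (R := R) d M)
    (hb₁ : b₁ ≤ maximalIdeal R) (hb₂ : b₂ ≤ maximalIdeal R)
    (hmul : ∀ r ∈ b₁, ∀ s ∈ b₂, ∀ k ∈ Submodule.torsionBySet R M I, r • s • k = 0)
    (hc : ∀ Q : PrimeSpectrum R, b₁ ≤ Q.asIdeal → b₂ ≤ Q.asIdeal → Order.coheight Q + 1 < d) :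
    (Submodule.torsionBySet R M I ⊓ Submodule.torsionBySet R M b₁) ⊓
        (Submodule.torsionBySet R M I ⊓ Submodule.torsionBySet R M b₂) = ⊥ ∧
      (Submodule.torsionBySet R M I ⊓ Submodule.torsionBySet R M b₁) ⊔
        (Submodule.torsionBySet R M I ⊓ Submodule.torsionBySet R M b₂) =
        Submodule.torsionBySet R M I := by
  constructor
  · rw [eq_bot_iff]
    rintro x ⟨⟨-, h₁⟩, -, h₂⟩
    by_contra hx
    obtain ⟨p, s, hs⟩ := exists_assElt (R := R) (x := x) hx
    refine (hc p (fun r hr => (hs r).1 ?_) (fun r hr => (hs r).1 ?_)).not_ge ?_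
    · rw [smul_comm, (Submodule.mem_torsionBySet_iff _ _).1 h₁ ⟨r, hr⟩, smul_zero]
    · rw [smul_comm, (Submodule.mem_torsionBySet_iff _ _).1 h₂ ⟨r, hr⟩, smul_zero]
    · rw [hM.coheight_eq hs]
      exact le_self_add
  · refine le_antisymm (sup_le inf_le_left inf_le_left) fun k hk => ?_
    obtain ⟨t, rfl⟩ : ∃ t, d = t + 1 + 1 := by
      have := (le_add_self).trans_lt (hc (closedPoint R) hb₁ hb₂)
      norm_cast at this
      exact ⟨d - 2, by lia⟩
    have hlt : ∀ Q : PrimeSpectrum R, b₁ ⊔ b₂ ≤ Q.asIdeal →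
        Order.coheight Q < ((t + 1 : ℕ) : ℕ∞) := fun Q hQ => by
      have := hc Q (le_sup_left.trans hQ) (le_sup_right.trans hQ)
      rw [Nat.cast_add_one (t + 1)] at this
      exact lt_of_add_lt_add_right this
    obtain ⟨u, hub, hu⟩ := hM.exists_isSMulRegular (J := b₁ ⊔ b₂) fun Q hQ =>
      (hlt Q hQ).trans (by norm_cast; lia)
    obtain ⟨v, hvb, hv⟩ := (hM.quotSMulTop hu).exists_isSMulRegular (J := b₁ ⊔ b₂) hlt
    obtain ⟨u₁, hu₁, u₂, hu₂, rfl⟩ := Submodule.mem_sup.1 hub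
    obtain ⟨v₁, hv₁, v₂, hv₂, rfl⟩ := Submodule.mem_sup.1 hvb
    obtain ⟨w₁, hw₁⟩ : ∃ w, (u₁ + u₂) • w = u₂ • k := by
      refine exists_smul_eq_of_smul_eq_smul hv (y := v₂ • k) ?_
      rw [add_smul, add_smul, hmul v₁ hv₁ u₂ hu₂ k hk, hmul u₁ hu₁ v₂ hv₂ k hk, smul_comm]
    obtain ⟨w₂, hw₂⟩ : ∃ w, (u₁ + u₂) • w = u₁ • k := by
      refine exists_smul_eq_of_smul_eq_smul hv (y := v₁ • k) ?_
      rw [add_smul, add_smul, smul_comm v₂, smul_comm u₂, hmul v₁ hv₁ u₂ hu₂ k hk,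
        hmul u₁ hu₁ v₂ hv₂ k hk, smul_comm]
    have hk₁₂ : k = w₁ + w₂ := by
      refine hu ?_
      change (u₁ + u₂) • k = (u₁ + u₂) • (w₁ + w₂)
      rw [smul_add, hw₁, hw₂, add_smul, add_comm]
    rw [hk₁₂]
    refine Submodule.add_mem_sup ⟨?_, ?_⟩ ⟨?_, ?_⟩ <;>
      refine mem_torsionBySet_of_smul hu ?_
    · rw [hw₁]
      exact Submodule.smul_mem _ _ hk
    · rw [hw₁, Submodule.mem_torsionBySet_iff]
      exact fun r => hmul r r.2 u₂ hu₂ k hk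
    · rw [hw₂]
      exact Submodule.smul_mem _ _ hk
    · rw [hw₂, Submodule.mem_torsionBySet_iff]
      intro r
      rw [smul_comm]
      exact hmul u₁ hu₁ r r.2 k hk

theorem Good.finite_primesOver {I : Ideal R} {d : ℕ} (hM : Good (R := R) d M)
    (hsupp : primesOver I d ⊆ Module.support R M) : (primesOver I d).Finite := by
  refine Set.Finite.of_finite_image ((associatedPrimes.finite R M).subset ?_)
    (f := PrimeSpectrum.asIdeal) fun _ _ _ _ h => PrimeSpectrum.ext h
  rintro _ ⟨p, hp, rfl⟩
  obtain ⟨k, -, hk⟩ := hM.exists_assElt_of_mem_primesOver hsupp hp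
  exact hk.mem_associatedPrimes

/-- A separation of the primes of coheight `d` over `I` decomposes the `I`-torsion of `M`. -/
theorem Good.exists_decomposition {I : Ideal R} {d : ℕ} (hM : Good (R := R) d M)
    (hsupp : primesOver I d ⊆ Module.support R M) {S : Set (PrimeSpectrum R)}
    (h₁ : (primesOver I d ∩ S).Nonempty) (h₂ : (primesOver I d \ S).Nonempty)
    (hS : ∀ p ∈ primesOver I d ∩ S, ∀ q ∈ primesOver I d \ S, ¬ Linked d p q) :
    ∃ K₁ K₂ : Submodule R M, K₁ ⊓ K₂ = ⊥ ∧ K₁ ⊔ K₂ = Submodule.torsionBySet R M I ∧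
      K₁ ≠ ⊥ ∧ K₂ ≠ ⊥ := by
  have hfin := hM.finite_primesOver hsupp
  obtain ⟨U₁, hU₁⟩ := (hfin.subset (Set.inter_subset_left (t := S))).exists_finset
  obtain ⟨U₂, hU₂⟩ := (hfin.subset (Set.sdiff_subset (t := S))).exists_finset
  set a₁ : Ideal R := U₁.inf PrimeSpectrum.asIdeal with ha₁
  set a₂ : Ideal R := U₂.inf PrimeSpectrum.asIdeal with ha₂
  have hrad : a₁ * a₂ ≤ (Module.annihilator R (Submodule.torsionBySet R M I)).radical := by
    rw [Ideal.radical_eq_sInf]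
    refine le_sInf fun Q ⟨hQ, hQp⟩ => ?_
    have hQs : (⟨Q, hQp⟩ : PrimeSpectrum R) ∈
        Module.support R (Submodule.torsionBySet R M I) := by
      rw [Module.mem_support_iff_of_finite]
      exact hQ
    obtain ⟨q, hqQ, ⟨y, hyK⟩, hy⟩ := exists_assElt_le_of_mem_support hQs
    have hy' := assElt_coe_iff.2 hy
    have hq : q ∈ primesOver I d :=
      ⟨fun r hr => (hy' r).1 ((Submodule.mem_torsionBySet_iff _ _).1 hyK ⟨r, hr⟩),
        hM.coheight_eq hy'⟩
    refine Ideal.mul_le_inf.trans (le_trans ?_ (show q.asIdeal ≤ Q from hqQ))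
    by_cases hqS : q ∈ S
    · exact inf_le_left.trans (Finset.inf_le ((hU₁ q).2 ⟨hq, hqS⟩))
    · exact inf_le_right.trans (Finset.inf_le ((hU₂ q).2 ⟨hq, hqS⟩))
  obtain ⟨N, hN⟩ : ∃ N, a₁ ^ (N + 1) * a₂ ^ (N + 1) ≤
      Module.annihilator R (Submodule.torsionBySet R M I) := by
    obtain ⟨N, hN⟩ := Ideal.exists_pow_le_of_le_radical_of_fg hrad (IsNoetherian.noetherian _)
    exact ⟨N, (mul_pow a₁ a₂ (N + 1)).ge.trans ((Ideal.pow_le_pow_right N.le_succ).trans hN)⟩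
  have hle₁ : ∀ Q : PrimeSpectrum R, a₁ ^ (N + 1) ≤ Q.asIdeal →
      ∃ p ∈ primesOver I d ∩ S, p ≤ Q := by
    intro Q hQ
    obtain ⟨p, hp, hpQ⟩ := (Ideal.IsPrime.inf_le' Q.2).1 (Q.2.le_of_pow_le hQ)
    exact ⟨p, (hU₁ p).1 hp, hpQ⟩
  have hle₂ : ∀ Q : PrimeSpectrum R, a₂ ^ (N + 1) ≤ Q.asIdeal →
      ∃ p ∈ primesOver I d \ S, p ≤ Q := by
    intro Q hQ
    obtain ⟨p, hp, hpQ⟩ := (Ideal.IsPrime.inf_le' Q.2).1 (Q.2.le_of_pow_le hQ)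
    exact ⟨p, (hU₂ p).1 hp, hpQ⟩
  have hmul : ∀ r ∈ a₁ ^ (N + 1), ∀ s ∈ a₂ ^ (N + 1), ∀ k ∈ Submodule.torsionBySet R M I,
      r • s • k = 0 := by
    intro r hr s hs k hk
    have := Module.mem_annihilator.1 (hN (Ideal.mul_mem_mul hr hs)) ⟨k, hk⟩
    rw [← mul_smul]
    exact congrArg Subtype.val this
  obtain ⟨p, hp⟩ := h₁
  obtain ⟨q, hq⟩ := h₂
  have hself : ∀ {p q : PrimeSpectrum R}, p ∈ primesOver I d → q ∈ primesOver I d → p ≤ q →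
      Linked d p q := fun {p q} _ hq hpq => ⟨q, hpq, le_rfl, by rw [hq.2]; simp⟩
  have hne₁ : ¬ a₂ ^ (N + 1) ≤ p.asIdeal := fun h => by
    obtain ⟨q', hq', hle⟩ := hle₂ p h
    exact hS p hp q' hq' (hself hq'.1 hp.1 hle).symm
  have hne₂ : ¬ a₁ ^ (N + 1) ≤ q.asIdeal := fun h => by
    obtain ⟨p', hp', hle⟩ := hle₁ q h
    exact hS p' hp' q hq (hself hp'.1 hq.1 hle)
  have hc : ∀ Q : PrimeSpectrum R, a₁ ^ (N + 1) ≤ Q.asIdeal → a₂ ^ (N + 1) ≤ Q.asIdeal →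
      Order.coheight Q + 1 < d := by
    intro Q hQ₁ hQ₂
    obtain ⟨p', hp', hpQ⟩ := hle₁ Q hQ₁
    obtain ⟨q', hq', hqQ⟩ := hle₂ Q hQ₂
    by_contra hcon
    exact hS p' hp' q' hq' ⟨Q, hpQ, hqQ, not_lt.1 hcon⟩
  have hm₁ : a₁ ^ (N + 1) ≤ maximalIdeal R := (Ideal.pow_le_self N.succ_ne_zero).trans
    ((Finset.inf_le ((hU₁ p).2 hp)).trans (le_maximalIdeal p.2.ne_top))
  have hm₂ : a₂ ^ (N + 1) ≤ maximalIdeal R := (Ideal.pow_le_self N.succ_ne_zero).trans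
    ((Finset.inf_le ((hU₂ q).2 hq)).trans (le_maximalIdeal q.2.ne_top))
  obtain ⟨hinf, hsup⟩ := hM.isCompl_torsionBySet (I := I) hm₁ hm₂ hmul hc
  refine ⟨_, _, hinf, hsup, ?_, ?_⟩
  · obtain ⟨s, hs, hsp⟩ := SetLike.not_le_iff_exists.1 hne₁
    obtain ⟨k, hk, hpk⟩ := hM.exists_assElt_of_mem_primesOver hsupp hp.1
    refine (Submodule.ne_bot_iff _).2
      ⟨s • k, ⟨Submodule.smul_mem _ _ hk, ?_⟩, fun h0 => hsp ((hpk s).1 h0)⟩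
    exact (Submodule.mem_torsionBySet_iff _ _).2 fun r => hmul r r.2 s hs k hk
  · obtain ⟨s, hs, hsp⟩ := SetLike.not_le_iff_exists.1 hne₂
    obtain ⟨k, hk, hpk⟩ := hM.exists_assElt_of_mem_primesOver hsupp hq.1
    refine (Submodule.ne_bot_iff _).2
      ⟨s • k, ⟨Submodule.smul_mem _ _ hk, ?_⟩, fun h0 => hsp ((hpk s).1 h0)⟩
    refine (Submodule.mem_torsionBySet_iff _ _).2 fun r => ?_
    rw [smul_comm]
    exact hmul s hs r r.2 k hk

end Decompose

section EndLocal

theorem isPrecomplete_of_finite {R : Type*} [CommRing R] {I : Ideal R} [IsPrecomplete I R]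
    {M : Type*} [AddCommGroup M] [Module R M] [Module.Finite R M] : IsPrecomplete I M := by
  obtain ⟨k, x, hx⟩ := Module.Finite.exists_fin (R := R) (M := M)
  refine ⟨fun f hf => ?_⟩
  have hmem : ∀ n, ∃ a : Fin k → R, (∀ i, a i ∈ I ^ n) ∧ ∑ i, a i • x i = f (n + 1) - f n := by
    intro n
    have h := SModEq.sub_mem.1 (hf n.le_succ).symm
    rw [← hx, Submodule.mem_ideal_smul_span_iff_exists_sum] at h
    obtain ⟨a, ha, hsum⟩ := h
    exact ⟨a, ha, by rw [← hsum, Finsupp.sum_fintype _ _ (by simp)]⟩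
  choose a ha hsum using hmem
  have hlim : ∀ i, ∃ L : R, ∀ n, ∑ j ∈ Finset.range n, a j i ≡ L [SMOD (I ^ n • ⊤ : Ideal R)] := by
    intro i
    refine IsPrecomplete.prec inferInstance fun {m n} hmn => ?_
    rw [SModEq.comm, SModEq.sub_mem, ← Finset.sum_range_add_sum_Ico _ hmn, add_sub_cancel_left]
    refine Submodule.sum_mem _ fun j hj => ?_
    rw [smul_eq_mul, Ideal.mul_top]
    exact Ideal.pow_le_pow_right (Finset.mem_Ico.1 hj).1 (ha j i)
  choose L hL using hlim
  refine ⟨f 0 + ∑ i, L i • x i, fun n => ?_⟩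
  have hfn : f n = f 0 + ∑ i, (∑ j ∈ Finset.range n, a j i) • x i := by
    induction n with
    | zero => simp
    | succ n ih =>
      simp_rw [Finset.sum_range_succ, add_smul, Finset.sum_add_distrib]
      rw [hsum, ← add_assoc, ← ih, add_sub_cancel]
  rw [hfn, SModEq.sub_mem, add_sub_add_left_eq_sub, ← Finset.sum_sub_distrib]
  refine Submodule.sum_mem _ fun i _ => ?_
  rw [← sub_smul]
  have h := SModEq.sub_mem.1 (hL i n)
  rw [smul_eq_mul, Ideal.mul_top] at h
  exact Submodule.smul_mem_smul h trivial

variable {R : Type*} [CommRing R] [IsLocalRing R] [IsNoetherianRing R]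
  [IsAdicComplete (maximalIdeal R) R]

theorem isAdicComplete_map_of_finite {S : Type*} [CommRing S] [Algebra R S] [Module.Finite R S] :
    IsAdicComplete ((maximalIdeal R).map (algebraMap R S)) S where
  toIsHausdorff := IsHausdorff.map_algebraMap_iff.2 inferInstance
  toIsPrecomplete := IsPrecomplete.map_algebraMap_iff.2 isPrecomplete_of_finite

/-- Fitting's lemma for an element `s` of a finite algebra over a complete local ring: there is an
idempotent `e` such that, modulo the Jacobson radical, `s` is invertible on `e` and nilpotent on
`1 - e`. -/
theorem exists_isIdempotentElem_pow_mul {S : Type*} [CommRing S] [Algebra R S]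
    [Module.Finite R S] (s : S) :
    ∃ (e y : S) (n : ℕ), IsIdempotentElem e ∧ s * y - e ∈ (⊥ : Ideal S).jacobson ∧
      s ^ n - s ^ n * e ∈ (⊥ : Ideal S).jacobson := by
  set J := (maximalIdeal R).map (algebraMap R S) with hJ
  have hc : IsAdicComplete J S := isAdicComplete_map_of_finite
  have hjac : J ≤ (⊥ : Ideal S).jacobson := IsAdicComplete.le_jacobson_bot J
  let _ : Field (R ⧸ maximalIdeal R) := Ideal.Quotient.field _
  have : Module.Finite (R ⧸ maximalIdeal R) (S ⧸ J) :=
    Module.Finite.of_restrictScalars_finite R _ _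
  have : IsArtinianRing (S ⧸ J) := IsArtinianRing.of_finite (R ⧸ maximalIdeal R) _
  obtain ⟨n, y, hy⟩ := IsArtinian.exists_pow_succ_smul_dvd (Ideal.Quotient.mk J s) (1 : S ⧸ J)
  rw [smul_eq_mul, smul_eq_mul, mul_one] at hy
  obtain ⟨y, rfl⟩ := Ideal.Quotient.mk_surjective y
  set σ := Ideal.Quotient.mk J s
  set η := Ideal.Quotient.mk J y
  have hpow : ∀ k, σ ^ (n + k) * η ^ k = σ ^ n := by
    intro k
    induction k with
    | zero => simp
    | succ k ih =>
      calc σ ^ (n + (k + 1)) * η ^ (k + 1) = (σ ^ n.succ * η) * (σ ^ k * η ^ k) := by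
            rw [Nat.succ_eq_add_one]; ring
        _ = σ ^ n := by rw [hy, ← mul_assoc, ← pow_add, ih]
  set e₀ : S := s ^ n * y ^ n with he₀
  have hσ : σ ^ n * (σ ^ n * η ^ n) = σ ^ n := by rw [← mul_assoc, ← pow_add, hpow]
  have hid : e₀ ^ 2 - e₀ ∈ J := by
    rw [← Ideal.Quotient.mk_eq_mk_iff_sub_mem]
    simp only [he₀, map_mul, map_pow]
    calc (σ ^ n * η ^ n) ^ 2 = (σ ^ n * (σ ^ n * η ^ n)) * η ^ n := by ring
      _ = σ ^ n * η ^ n := by rw [hσ]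
  obtain ⟨e, he, hee⟩ := HenselianRing.is_henselian (R := S) (I := J)
    (Polynomial.X ^ 2 - Polynomial.X) (by monicity!) e₀ (by simpa using hid) (by
      have h4 : (2 * e₀ - 1) * (2 * e₀ - 1) = 1 + 4 * (e₀ ^ 2 - e₀) := by ring
      have h1 : Ideal.Quotient.mk J ((2 * e₀ - 1) * (2 * e₀ - 1)) = 1 := by
        rw [h4, map_add, map_mul, Ideal.Quotient.eq_zero_iff_mem.2 hid]
        simp
      have h2 : Polynomial.eval e₀ (Polynomial.derivative
          (Polynomial.X ^ 2 - Polynomial.X : Polynomial S)) = 2 * e₀ - 1 := by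
        simp [one_add_one_eq_two]
      rw [h2]
      exact IsUnit.of_mul_eq_one _ ((map_mul _ _ _).symm.trans h1))
  have hee' := (Ideal.Quotient.mk_eq_mk_iff_sub_mem _ _).2 hee
  refine ⟨e, s ^ n * y ^ (n + 1), n, ?_, hjac ?_, hjac ?_⟩
  · have : e ^ 2 - e = 0 := by simpa using he
    rw [IsIdempotentElem, ← pow_two]
    exact sub_eq_zero.1 this
  · rw [← Ideal.Quotient.mk_eq_mk_iff_sub_mem, hee']
    simp only [he₀, map_mul, map_pow]
    calc σ * (σ ^ n * η ^ (n + 1)) = (σ ^ n.succ * η) * η ^ n := by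
          rw [Nat.succ_eq_add_one]; ring
      _ = σ ^ n * η ^ n := by rw [hy]
  · rw [← Ideal.Quotient.mk_eq_mk_iff_sub_mem, map_mul, hee']
    simp only [he₀, map_mul, map_pow]
    exact hσ.symm

variable {K : Type*} [AddCommGroup K] [Module R K] [Module.Finite R K]

theorem isUnit_or_isUnit_one_sub_of_indecomposable
    (hK : ∀ N₁ N₂ : Submodule R K, IsCompl N₁ N₂ → N₁ = ⊥ ∨ N₂ = ⊥) (f : Module.End R K) :
    IsUnit f ∨ IsUnit (1 - f) := by
  obtain ⟨p, hp, hpf⟩ := LinearMap.exists_monic_and_aeval_eq_zero R f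
  have : Module.Finite R (Polynomial R ⧸ Ideal.span {p}) := hp.finite_quotient
  let φ : (Polynomial R ⧸ Ideal.span {p}) →ₐ[R] Module.End R K :=
    Ideal.Quotient.liftₐ _ (Polynomial.aeval f) fun a ha => by
      obtain ⟨b, rfl⟩ := Ideal.mem_span_singleton'.1 ha
      rw [map_mul, hpf, mul_zero]
  obtain ⟨s, hs⟩ : ∃ s, φ s = f := ⟨Ideal.Quotient.mk _ Polynomial.X,
    (Ideal.Quotient.lift_mk _ _ _).trans (Polynomial.aeval_X f)⟩
  obtain ⟨e, y, n, he, h₁, h₂⟩ := exists_isIdempotentElem_pow_mul (R := R) s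
  have hjac : ∀ {j}, j ∈ (⊥ : Ideal (Polynomial R ⧸ Ideal.span {p})).jacobson →
      IsUnit (1 + j) := fun {j} hj => by
    simpa [add_comm] using Ideal.mem_jacobson_bot.1 hj 1
  have hφe : IsIdempotentElem (φ e) := he.map φ
  obtain h | h := hK _ _ (LinearMap.IsIdempotentElem.isCompl hφe)
  · right
    rw [LinearMap.range_eq_bot] at h
    have hcomm : Commute (1 - s) (∑ i ∈ Finset.range n, s ^ i) := Commute.all _ _
    have hu : IsUnit (φ ((1 - s) * ∑ i ∈ Finset.range n, s ^ i)) := by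
      have h0 : φ ((1 - s) * ∑ i ∈ Finset.range n, s ^ i) = φ (1 + -(s ^ n - s ^ n * e)) := by
        rw [mul_neg_geom_sum]
        simp [h, sub_eq_add_neg]
      rw [h0]
      exact (hjac (neg_mem h₂)).map φ
    rw [map_mul, (hcomm.map φ).isUnit_mul_iff, map_sub, map_one, hs] at hu
    exact hu.1
  · left
    have h1 : φ e = 1 := LinearMap.ext fun x => by
      refine LinearMap.ker_eq_bot.1 h ?_
      rw [← Module.End.mul_apply, hφe.eq, Module.End.one_apply]
    have hu : IsUnit (φ (s * y)) := by
      have h0 : φ (s * y) = φ (1 + (s * y - e)) := by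
        rw [map_add, map_sub, h1, map_one, add_sub_cancel]
      rw [h0]
      exact (hjac h₁).map φ
    rw [map_mul, ((Commute.all s y).map φ).isUnit_mul_iff, hs] at hu
    exact hu.1

theorem existsUnique_isMaximal_of_forall_isUnit {E : Type*} [Ring E] [Nontrivial E]
    (hE : ∀ f : E, IsUnit f ∨ IsUnit (1 - f)) : ∃! M : Ideal E, M.IsMaximal := by
  have hinv : ∀ f g : E, g * f = 1 → IsUnit f := by
    intro f g h
    have hid : IsIdempotentElem (f * g) := by
      rw [IsIdempotentElem, mul_assoc, ← mul_assoc g, h, one_mul]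
    obtain hu | hu := hE (f * g)
    · have h1 : f * g = 1 := hu.mul_left_cancel (hid.eq.trans (mul_one _).symm)
      exact ⟨⟨f, g, h1, h⟩, rfl⟩
    · have h0 : f * g = 0 := by
        refine hu.mul_left_cancel ?_
        rw [mul_zero, sub_mul, one_mul, hid.eq, sub_self]
      have : (1 : E) = 0 := by
        calc (1 : E) = (g * f) * (g * f) := by rw [h, mul_one]
          _ = g * (f * g) * f := by simp only [mul_assoc]
          _ = 0 := by rw [h0, mul_zero, zero_mul]
      exact (one_ne_zero this).elim
  have hle : ∀ f g : E, IsUnit (g * f) → IsUnit f := by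
    rintro f g ⟨u, hu⟩
    refine hinv f (↑u⁻¹ * g) ?_
    rw [mul_assoc, ← hu, Units.inv_mul]
  let M : Ideal E :=
    { carrier := {f | ¬ IsUnit f}
      zero_mem' := not_isUnit_zero
      add_mem' := by
        rintro f g hf hg ⟨u, hu⟩
        obtain h | h := hE (↑u⁻¹ * f)
        · exact hf (hle _ _ h)
        · refine hg (hle g ↑u⁻¹ ?_)
          rwa [← Units.inv_mul u, hu, mul_add, add_sub_cancel_left] at h
      smul_mem' := fun g f hf h => hf (hle f g h) }
  have hM : ∀ J : Ideal E, J ≠ ⊤ → J ≤ M := fun J hJ f hf hu => hJ (J.eq_top_of_isUnit_mem hf hu)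
  have hMtop : M ≠ ⊤ := (Ideal.ne_top_iff_one M).2 fun h => h isUnit_one
  have hMmax : M.IsMaximal := ⟨hMtop, fun J hJ => by
    by_contra h
    exact (hM J h).not_gt hJ⟩
  exact ⟨M, hMmax, fun J hJ => hJ.eq_of_le hMtop (hM J hJ.ne_top)⟩

/-- A finite module over a complete local ring is indecomposable iff its endomorphism ring has a
unique maximal left ideal. -/
theorem indecomposable_iff_existsUnique_isMaximal :
    (Nontrivial K ∧ ∀ N₁ N₂ : Submodule R K, IsCompl N₁ N₂ → N₁ = ⊥ ∨ N₂ = ⊥) ↔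
      ∃! M : Ideal (Module.End R K), M.IsMaximal := by
  constructor
  · rintro ⟨_, hK⟩
    exact existsUnique_isMaximal_of_forall_isUnit (isUnit_or_isUnit_one_sub_of_indecomposable hK)
  · rintro ⟨M, hM, huniq⟩
    refine ⟨?_, fun N₁ N₂ hN => ?_⟩
    · by_contra hK
      rw [not_nontrivial_iff_subsingleton] at hK
      exact hM.ne_top (Subsingleton.elim _ _)
    · have key : ∀ e : Module.End R K, IsIdempotentElem e → e ≠ 1 → e ∈ M := by
        intro e he hne
        obtain ⟨J, hJ, hle⟩ := Ideal.exists_le_maximal (Ideal.span {e}) fun htop => by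
          obtain ⟨a, ha⟩ := Submodule.mem_span_singleton.1 ((Ideal.eq_top_iff_one _).1 htop)
          refine hne ?_
          rw [smul_eq_mul] at ha
          rw [← one_mul e, ← ha, mul_assoc, he.eq]
        rw [← huniq J hJ]
        exact hle (Ideal.subset_span rfl)
      by_contra! hcon
      set e := Submodule.projection N₁ N₂ hN with he
      have hid : IsIdempotentElem e := Submodule.isIdempotentElem_projection hN
      refine hM.ne_top ((Ideal.eq_top_iff_one _).2 ?_)
      rw [← add_sub_cancel e 1]
      refine M.add_mem (key e hid fun h => hcon.2 ?_) (key _ hid.one_sub fun h => hcon.1 ?_)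
      · rw [← Submodule.ker_projection hN, ← he, h]
        exact LinearMap.ker_id
      · rw [← Submodule.range_projection hN, ← he, sub_eq_self.1 h, LinearMap.range_zero]

end EndLocal

theorem height_add_coheight_le_krullDim {α : Type*} [Preorder α] (a : α) :
    ((Order.height a + Order.coheight a : ℕ∞) : WithBot ℕ∞) ≤ Order.krullDim α := by
  have : Nonempty α := ⟨a⟩
  rw [Order.krullDim_eq_iSup_height_add_coheight_of_nonempty]
  exact WithBot.coe_le_coe.2 (le_iSup (fun a : α => Order.height a + Order.coheight a) a)

theorem ringKrullDim_quotient_asIdeal {A : Type*} [CommRing A] (p : PrimeSpectrum A) :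
    ringKrullDim (A ⧸ p.asIdeal) = Order.coheight p := by
  rw [ringKrullDim_quotient, Order.coheight_eq_krullDim_Ici]
  rfl

section QuotientSpectrum

variable {R : Type*} [CommRing R] (I : Ideal R)

/-- The embedding of `Spec (R/I)` into `Spec R`. -/
def specMk (p : PrimeSpectrum (R ⧸ I)) : PrimeSpectrum R :=
  PrimeSpectrum.comap (Ideal.Quotient.mk I) p

variable {I}

theorem specMk_le_specMk {p q : PrimeSpectrum (R ⧸ I)} : specMk I p ≤ specMk I q ↔ p ≤ q :=
  Ideal.comap_le_comap_iff_of_surjective _ Ideal.Quotient.mk_surjective _ _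

theorem specMk_lt_specMk {p q : PrimeSpectrum (R ⧸ I)} : specMk I p < specMk I q ↔ p < q := by
  rw [lt_iff_le_not_ge, lt_iff_le_not_ge, specMk_le_specMk, specMk_le_specMk]

theorem specMk_injective : Function.Injective (specMk I) :=
  PrimeSpectrum.comap_injective_of_surjective _ Ideal.Quotient.mk_surjective

theorem le_specMk (p : PrimeSpectrum (R ⧸ I)) : I ≤ (specMk I p).asIdeal := by
  intro r hr
  change Ideal.Quotient.mk I r ∈ p.asIdeal
  rw [Ideal.Quotient.eq_zero_iff_mem.2 hr]
  exact zero_mem _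

theorem exists_specMk_eq {P : PrimeSpectrum R} (hP : I ≤ P.asIdeal) : ∃ p, specMk I p = P := by
  have h : (Ideal.map (Ideal.Quotient.mk I) P.asIdeal).IsPrime :=
    Ideal.map_isPrime_of_surjective Ideal.Quotient.mk_surjective (by rwa [Ideal.mk_ker])
  refine ⟨⟨_, h⟩, PrimeSpectrum.ext ?_⟩
  change Ideal.comap _ (Ideal.map _ _) = _
  rw [Ideal.comap_map_of_surjective _ Ideal.Quotient.mk_surjective, ← RingHom.ker_eq_comap_bot,
    Ideal.mk_ker, sup_eq_left.2 hP]

theorem coheight_specMk (p : PrimeSpectrum (R ⧸ I)) :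
    Order.coheight (specMk I p) = Order.coheight p := by
  refine le_antisymm (Order.coheight_le fun s hs => ?_)
    (Order.coheight_le_coheight_apply_of_strictMono _ (fun _ _ => specMk_lt_specMk.2) _)
  have hle : ∀ i, I ≤ (s i).asIdeal := fun i =>
    (le_specMk p).trans (show specMk I p ≤ s i from hs ▸ s.head_le i)
  choose t ht using fun i => exists_specMk_eq (hle i)
  let s' : LTSeries (PrimeSpectrum (R ⧸ I)) :=
    { length := s.length
      toFun := t
      step := fun i => specMk_lt_specMk.1 (by rw [ht, ht]; exact s.step i) }
  exact Order.length_le_coheight (p := s') (specMk_le_specMk.1 (by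
    change specMk I p ≤ specMk I (t 0)
    rw [ht, ← hs]
    rfl))

theorem linked_specMk_iff {d : ℕ} {p q : PrimeSpectrum (R ⧸ I)} :
    Linked d (specMk I p) (specMk I q) ↔ Linked d p q := by
  constructor
  · rintro ⟨P, hp, hq, hP⟩
    obtain ⟨P, rfl⟩ := exists_specMk_eq ((le_specMk p).trans hp)
    exact ⟨P, specMk_le_specMk.1 hp, specMk_le_specMk.1 hq, by rwa [coheight_specMk] at hP⟩
  · rintro ⟨P, hp, hq, hP⟩
    exact ⟨specMk I P, specMk_le_specMk.2 hp, specMk_le_specMk.2 hq, by rwa [coheight_specMk]⟩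

theorem covBy_specMk {p q : PrimeSpectrum (R ⧸ I)} (h : p ⋖ q) : specMk I p ⋖ specMk I q := by
  refine ⟨specMk_lt_specMk.2 h.1, fun P hpP hPq => ?_⟩
  obtain ⟨P, rfl⟩ := exists_specMk_eq ((le_specMk p).trans hpP.le)
  exact h.2 (specMk_lt_specMk.1 hpP) (specMk_lt_specMk.1 hPq)

end QuotientSpectrum

theorem idealHeight_sup_eq_one_iff_linked {A : Type u} [CommRing A] {d : ℕ}
    (hA : ringKrullDim A = d) {p q : PrimeSpectrum A} (hp : Order.coheight p = d)
    (hq : Order.coheight q = d) (hne : p ≠ q)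
    (hcov : ∀ P, p ⋖ P → (d : ℕ∞) ≤ Order.coheight P + 1) :
    idealHeight A (p.asIdeal ⊔ q.asIdeal) = 1 ↔ Linked d p q := by
  have hlt : ∀ x : PrimeSpectrum A, p ≤ x → q ≤ x → p < x := fun x hpx hqx => by
    refine lt_of_le_of_ne hpx ?_
    rintro rfl
    exact hne (eq_of_le_of_coheight_le hqx hq.le hp.ge).symm
  constructor
  · intro h
    have : Nonempty {x : PrimeSpectrum A // p.asIdeal ⊔ q.asIdeal ≤ x.asIdeal} := by
      by_contra hemp
      rw [not_nonempty_iff] at hemp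
      rw [idealHeight, iInf_of_empty] at h
      exact absurd h (by simp)
    obtain ⟨⟨x, hx⟩, hx1⟩ := ENat.exists_eq_iInf
      fun x : {x : PrimeSpectrum A // p.asIdeal ⊔ q.asIdeal ≤ x.asIdeal} => Order.height x.1
    rw [← idealHeight, h] at hx1
    have hpx : p ≤ x := le_sup_left.trans hx
    have hqx : q ≤ x := le_sup_right.trans hx
    refine ⟨x, hpx, hqx, hcov x ⟨hlt x hpx hqx, fun y hpy hyx => ?_⟩⟩
    have h1 := Order.height_add_one_le hyx
    have h2 := Order.height_add_one_le hpy
    change Order.height x = 1 at hx1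
    rw [hx1] at h1
    have h3 := (add_le_add_left (le_add_self.trans h2) 1).trans h1
    norm_num at h3
  · rintro ⟨P, hpP, hqP, hP⟩
    refine le_antisymm ((iInf_le _ ⟨P, sup_le hpP hqP⟩).trans ?_) (le_iInf fun x => ?_)
    · have h := height_add_coheight_le_krullDim P
      change _ ≤ ringKrullDim A at h
      rw [hA] at h
      have h1 : Order.height P + Order.coheight P ≤ d := WithBot.coe_le_coe.1 h
      have h2 := h1.trans hP
      rw [add_comm] at h2
      refine (ENat.add_le_add_iff_left (ne_top_of_le_ne_top ?_ (le_add_self.trans h1))).1 h2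
      exact ENat.natCast_ne_top d
    · exact le_add_self.trans
        (Order.height_add_one_le (hlt x (le_sup_left.trans x.2) (le_sup_right.trans x.2)))

theorem ringGraph_connected_iff {R : Type u} [CommRing R] {I : Ideal R} {d : ℕ}
    (hd : ringKrullDim (R ⧸ I) = d)
    (hcov : ∀ p ∈ primesOver I d, ∀ P, p ⋖ P → (d : ℕ∞) ≤ Order.coheight P + 1) :
    (ringGraph (R ⧸ I)).Connected ↔ (primesOver I d).Nonempty ∧
      ¬ ∃ S : Set (PrimeSpectrum R),
        (primesOver I d ∩ S).Nonempty ∧ (primesOver I d \ S).Nonempty ∧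
          ∀ p ∈ primesOver I d ∩ S, ∀ q ∈ primesOver I d \ S, ¬ Linked d p q := by
  let V := {p : Ideal (R ⧸ I) // p.IsPrime ∧ ringKrullDim ((R ⧸ I) ⧸ p) = ringKrullDim (R ⧸ I)}
  let f : V → PrimeSpectrum R := fun p => specMk I ⟨p.1, p.2.1⟩
  have hcoh : ∀ v : V, Order.coheight (⟨v.1, v.2.1⟩ : PrimeSpectrum (R ⧸ I)) = d := by
    intro v
    have h := v.2.2.trans hd
    have h1 := ringKrullDim_quotient_asIdeal (⟨v.1, v.2.1⟩ : PrimeSpectrum (R ⧸ I))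
    exact WithBot.coe_injective (h1.symm.trans h)
  have hf : ∀ v, f v ∈ primesOver I d := fun v =>
    ⟨le_specMk _, (coheight_specMk _).trans (hcoh v)⟩
  have hsurj : ∀ P ∈ primesOver I d, ∃ v, f v = P := by
    rintro P ⟨hIP, hP⟩
    obtain ⟨p, rfl⟩ := exists_specMk_eq hIP
    refine ⟨⟨p.asIdeal, p.2, ?_⟩, rfl⟩
    rw [ringKrullDim_quotient_asIdeal, hd, ← coheight_specMk, hP]
    rfl
  have hadj : ∀ v w : V, v ≠ w →
      ((ringGraph (R ⧸ I)).Adj v w ↔ Linked d (f v) (f w)) := by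
    intro v w hvw
    have hne : (⟨v.1, v.2.1⟩ : PrimeSpectrum (R ⧸ I)) ≠ ⟨w.1, w.2.1⟩ := fun h =>
      hvw (Subtype.ext (congrArg PrimeSpectrum.asIdeal h))
    have h := idealHeight_sup_eq_one_iff_linked hd (hcoh v) (hcoh w) hne fun P hP => by
      rw [← coheight_specMk]
      exact hcov _ (hf v) _ (covBy_specMk hP)
    rw [ringGraph, SimpleGraph.fromRel_adj, sup_comm w.1 v.1, or_self, linked_specMk_iff, ← h]
    exact and_iff_right hvw
  rw [SimpleGraph.connected_iff, and_comm]
  refine and_congr ⟨fun ⟨v⟩ => ⟨f v, hf v⟩, fun ⟨P, hP⟩ => ?_⟩ ⟨fun hpre => ?_, fun hS => ?_⟩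
  · obtain ⟨v, -⟩ := hsurj P hP
    exact ⟨v⟩
  · rintro ⟨S, ⟨p, hp, hpS⟩, ⟨q, hq, hqS⟩, hS⟩
    obtain ⟨v, rfl⟩ := hsurj p hp
    obtain ⟨w, rfl⟩ := hsurj q hq
    have hvw := (SimpleGraph.reachable_iff_reflTransGen _ _).1 (hpre v w)
    refine hqS ?_
    clear hqS hq
    induction hvw with
    | refl => exact hpS
    | tail _ hab ih =>
      by_contra hcon
      exact hS _ ⟨hf _, ih⟩ _ ⟨hf _, hcon⟩ ((hadj _ _ hab.ne).1 hab)
  · intro v w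
    by_contra hvw
    refine hS ⟨{P | ∃ x, f x = P ∧ (ringGraph (R ⧸ I)).Reachable v x},
      ⟨f v, hf v, v, rfl, .rfl⟩, ⟨f w, hf w, ?_⟩, ?_⟩
    · rintro ⟨x, hx, hvx⟩
      have : x = w := Subtype.ext (congrArg PrimeSpectrum.asIdeal (specMk_injective hx))
      exact hvw (this ▸ hvx)
    · rintro _ ⟨-, x, rfl, hvx⟩ q ⟨hq, hqS⟩ hlink
      obtain ⟨y, rfl⟩ := hsurj q hq
      have hxy : x ≠ y := by
        rintro rfl
        exact hqS ⟨x, rfl, hvx⟩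
      exact hqS ⟨y, rfl, hvx.trans ((hadj x y hxy).2 hlink).reachable⟩

section CanonicalModule

variable {R : Type u} [CommRing R] [IsLocalRing R] [IsNoetherianRing R]

theorem Good.le_coheight_add_one_of_covBy {M : Type u} [AddCommGroup M] [Module R M]
    [Module.Finite R M] {d : ℕ} (hM : Good (R := R) d M) {p P : PrimeSpectrum R} {m : M}
    (hm : AssElt p.asIdeal m) (hpP : p ⋖ P) : (d : ℕ∞) ≤ Order.coheight P + 1 := by
  by_contra hlt
  rw [not_le] at hlt
  have hP : Order.coheight P < d := lt_of_le_of_lt le_self_add hlt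
  obtain _ | t := d
  · simp at hlt
  obtain ⟨y, hyP, hy⟩ := hM.exists_isSMulRegular (J := P.asIdeal) fun Q hQ =>
    lt_of_le_of_lt (Order.coheight_anti hQ) hP
  obtain ⟨q, hpq, hqP, hyq, z, hz⟩ := exists_assElt_quotSMulTop hy hm hpP.le hyP
  have hlt' : p < q := lt_of_le_of_ne hpq fun h => hm.notMem_of_isSMulRegular hy (h ▸ hyq)
  obtain rfl : q = P := by
    by_contra hne
    exact hpP.2 hlt' (lt_of_le_of_ne hqP hne)
  rw [(hM.quotSMulTop hy).coheight_eq hz] at hlt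
  exact absurd hlt (by simp)

/-- A module isomorphic to the `I`-torsion of `M` is indecomposable iff the primes of coheight `d`
over `I` cannot be separated. -/
theorem Good.indecomposable_iff {M E : Type u} [AddCommGroup M] [Module R M] [Module.Finite R M]
    [AddCommGroup E] [Module R E] {I : Ideal R} {d : ℕ} (hM : Good (R := R) d M)
    (hsupp : primesOver I d ⊆ Module.support R M) {ψ : E →ₗ[R] M}
    (hψ : Function.Injective ψ) (hrange : LinearMap.range ψ = Submodule.torsionBySet R M I) :
    (Nontrivial E ∧ ∀ N₁ N₂ : Submodule R E, IsCompl N₁ N₂ → N₁ = ⊥ ∨ N₂ = ⊥) ↔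
      (primesOver I d).Nonempty ∧ ¬ ∃ S : Set (PrimeSpectrum R),
        (primesOver I d ∩ S).Nonempty ∧ (primesOver I d \ S).Nonempty ∧
          ∀ p ∈ primesOver I d ∩ S, ∀ q ∈ primesOver I d \ S, ¬ Linked d p q := by
  refine and_congr ⟨fun hE => ?_, fun ⟨p, hp⟩ => ?_⟩ ⟨?_, fun hS N₁ N₂ hN => ?_⟩
  · obtain ⟨x, hx⟩ := exists_ne (0 : E)
    obtain ⟨p, hp, -⟩ := hM.exists_mem_primesOver hrange.le fun h =>
      hx (hψ (((Submodule.eq_bot_iff _).1 h _ ⟨x, rfl⟩).trans ψ.map_zero.symm))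
    exact ⟨p, hp⟩
  · obtain ⟨k, hk, hkp⟩ := hM.exists_assElt_of_mem_primesOver hsupp hp
    rw [← hrange] at hk
    obtain ⟨x, rfl⟩ := hk
    exact ⟨x, 0, fun h => hkp.ne_zero (by rw [h, map_zero])⟩
  · rintro hE ⟨S, h₁, h₂, hS⟩
    obtain ⟨K₁, K₂, hinf, hsup, hK₁, hK₂⟩ := hM.exists_decomposition hsupp h₁ h₂ hS
    have hmap : ∀ K ≤ Submodule.torsionBySet R M I, (K.comap ψ).map ψ = K := fun K hK => by
      rw [Submodule.map_comap_eq, hrange, inf_eq_right.2 hK]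
    have hle₁ := hmap K₁ (le_sup_left.trans hsup.le)
    have hle₂ := hmap K₂ (le_sup_right.trans hsup.le)
    have hcompl : IsCompl (K₁.comap ψ) (K₂.comap ψ) := by
      refine ⟨disjoint_iff.2 ?_, codisjoint_iff.2 ?_⟩
      · rw [← Submodule.comap_inf, hinf, Submodule.comap_bot, LinearMap.ker_eq_bot.2 hψ]
      · apply Submodule.map_injective_of_injective hψ
        rw [Submodule.map_sup, hle₁, hle₂, hsup, Submodule.map_top, hrange]
    refine (hE _ _ hcompl).elim (fun h => hK₁ ?_) fun h => hK₂ ?_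
    · rw [← hle₁, h, Submodule.map_bot]
    · rw [← hle₂, h, Submodule.map_bot]
  · by_contra! hne
    refine hS (hM.exists_separation hsupp (K₁ := N₁.map ψ) (K₂ := N₂.map ψ) ?_ ?_ ?_ ?_)
    · rw [← Submodule.map_inf ψ hψ, hN.inf_eq_bot, Submodule.map_bot]
    · rw [← Submodule.map_sup, hN.sup_eq_top, Submodule.map_top, hrange]
    · exact fun h => hne.1 (Submodule.map_injective_of_injective hψ
        (h.trans (Submodule.map_bot ψ).symm))
    · exact fun h => hne.2 (Submodule.map_injective_of_injective hψ
        (h.trans (Submodule.map_bot ψ).symm))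

end CanonicalModule

section Torsion

variable {R : Type u} [CommRing R] (I : Ideal R) (M : Type u) [AddCommGroup M] [Module R M]

/-- Evaluation at `1` identifies `Hom(R/I, M)` with the `I`-torsion of `M`. -/
def evalOneQuotient : (R ⧸ I →ₗ[R] M) →ₗ[R] M := LinearMap.applyₗ (1 : R ⧸ I)

theorem evalOneQuotient_injective : Function.Injective (evalOneQuotient I M) := by
  intro f g h
  ext
  exact h

theorem range_evalOneQuotient :
    LinearMap.range (evalOneQuotient I M) = Submodule.torsionBySet R M I := by
  ext x
  rw [Submodule.mem_torsionBySet_iff]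
  constructor
  · rintro ⟨f, rfl⟩ ⟨r, hr⟩
    change r • f 1 = 0
    rw [← map_smul, ← map_zero f]
    congr 1
    rw [Algebra.smul_def, mul_one]
    exact Ideal.Quotient.eq_zero_iff_mem.2 hr
  · intro hx
    refine ⟨Submodule.liftQ I (LinearMap.toSpanSingleton R M x) fun r hr => hx ⟨r, hr⟩, ?_⟩
    exact one_smul R x

end Torsion

theorem IsGorensteinLocalRing.good {R : Type u} [CommRing R] [IsLocalRing R]
    (h : IsGorensteinLocalRing R) {n : ℕ} (hn : ringKrullDim R = n) : Good (R := R) n R := by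
  obtain ⟨-, m, hm, hvan, ⟨e⟩⟩ := h
  obtain rfl : m = n := by exact_mod_cast hm.symm.trans hn
  refine ⟨fun i hi => hvan i hi.ne, ⟨e, e.injective⟩, fun P _ => ?_⟩
  have h := Order.coheight_le_krullDim P
  exact WithBot.coe_le_coe.1 (h.trans hn.le)

theorem coheight_le_of_ringKrullDim_quotient {R : Type u} [CommRing R] {I : Ideal R} {d : ℕ}
    (hd : ringKrullDim (R ⧸ I) = d) {P : PrimeSpectrum R} (hP : I ≤ P.asIdeal) :
    Order.coheight P ≤ d := by
  obtain ⟨p, rfl⟩ := exists_specMk_eq hP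
  rw [coheight_specMk]
  exact WithBot.coe_le_coe.1 ((Order.coheight_le_krullDim p).trans hd.le)

/-- Let `(R, 𝔪)` be a complete Gorenstein local ring, `I ⊆ R` an
ideal, `A = R/I` and `K(A) = Ext^c_R(A, R)` (`c = dim R - dim A`) the canonical
module of `A`.  The following are equivalent: (i) `K(A)` is indecomposable;
(ii) the graph `𝔾_A` is connected (`V(0_d)` is connected in codimension one);
(iii) `K(K(A)) ≅ Hom_R(K(A), K(A))` is a local ring. -/
theorem canonical_module_indecomposable_iff_graph_connected_iff_endo_local
    (R : Type u) [CommRing R] [IsLocalRing R]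
    (hGor : IsGorensteinLocalRing R) (hComplete : IsAdicComplete (maximalIdeal R) R)
    (I : Ideal R) (n d c : ℕ) (hn : ringKrullDim R = n)
    (hd : ringKrullDim (R ⧸ I) = d) (hc : c + d = n) :
    ((Nontrivial ↥(ExtM R c (ModuleCat.of R (R ⧸ I)) (ModuleCat.of R R)) ∧
        ∀ N₁ N₂ : Submodule R ↥(ExtM R c (ModuleCat.of R (R ⧸ I)) (ModuleCat.of R R)),
          IsCompl N₁ N₂ → N₁ = ⊥ ∨ N₂ = ⊥) ↔
      (ringGraph (R ⧸ I)).Connected) ∧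
    ((ringGraph (R ⧸ I)).Connected ↔
      ∃! M : Ideal (Module.End R
        ↥(ExtM R c (ModuleCat.of R (R ⧸ I)) (ModuleCat.of R R))), M.IsMaximal) := by
  have := hGor.1
  have hI : ∀ P : PrimeSpectrum R, I ≤ P.asIdeal → Order.coheight P ≤ d := fun P hP =>
    coheight_le_of_ringKrullDim_quotient hd hP
  obtain ⟨M, _, hM, hsupp, -, ⟨e⟩⟩ :=
    Good.exists_ext_equiv hI c (hGor.good (n := d + c) (by rw [hn, ← hc, add_comm]))
  replace hsupp : primesOver I d ⊆ Module.support R M := fun P hP =>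
    hsupp P (by rw [Module.support_of_algebra, PrimeSpectrum.mem_zeroLocus,
      (RingHom.injective_iff_ker_eq_bot _).1 (FaithfulSMul.algebraMap_injective R R)]; simp) hP.1
  let ψ := evalOneQuotient I M ∘ₗ e.toLinearMap
  have hψ : Function.Injective ψ := (evalOneQuotient_injective I M).comp e.injective
  have hrange : LinearMap.range ψ = Submodule.torsionBySet R M I := by
    rw [LinearMap.range_comp, LinearEquiv.range, Submodule.map_top, range_evalOneQuotient]
  have : Module.Finite R (ExtM R c (ModuleCat.of R (R ⧸ I)) (ModuleCat.of R R)) :=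
    Module.Finite.of_injective ψ hψ
  have key := (hM.indecomposable_iff hsupp hψ hrange).trans
    (ringGraph_connected_iff hd fun p hp P hpP => by
      obtain ⟨k, -, hk⟩ := hM.exists_assElt_of_mem_primesOver hsupp hp
      exact hM.le_coheight_add_one_of_covBy hk hpP).symm
  exact ⟨key, key.symm.trans indecomposable_iff_existsUnique_isMaximal⟩
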